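/- arXiv:1809.07254 — 5 statements merged into one kernel-verified Lean document; each statement's English description precedes it below -/
import Mathlib

section
/- Let n ≥ 1, let μ ∈ ℝⁿ, let Σ be a symmetric n×n real matrix such that Σ − μμᵀ is positive semidefinite, let ε ∈ (0,1), and let a ∈ ℝⁿ, b ∈ ℝ. Then every Borel probability distribution P on ℝⁿ with mean μ and second moment matrix Σ satisfies P({ξ : aᵀξ ≤ b}) ≥ 1 − ε if and only if √(((1−ε)/ε)·aᵀ(Σ − μμᵀ)a) ≤ b − aᵀμ. -/
open MeasureTheory Matrix

/-- A finitely supported probability measure, with expectations given by weighted sums. -/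
lemma exists_isProbabilityMeasure_integral_eq_sum {ι α : Type*} [Fintype ι] [MeasurableSpace α]
    [MeasurableSingletonClass α] (p : ι → ℝ) (hp : ∀ i, 0 ≤ p i) (hp1 : ∑ i, p i = 1)
    (x : ι → α) :
    ∃ P : Measure α, IsProbabilityMeasure P ∧
      ∀ f : α → ℝ, Integrable f P ∧ ∫ ξ, f ξ ∂P = ∑ i, p i * f (x i) := by
  refine ⟨∑ i, ENNReal.ofReal (p i) • Measure.dirac (x i), ⟨?_⟩, fun f => ?_⟩
  · simp [← ENNReal.ofReal_sum_of_nonneg (fun i _ => hp i), hp1]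
  · have hint : ∀ i ∈ (Finset.univ : Finset ι),
        Integrable f (ENNReal.ofReal (p i) • Measure.dirac (x i)) := fun i _ =>
      (integrable_dirac (by simp)).smul_measure ENNReal.ofReal_ne_top
    refine ⟨integrable_finsetSum_measure.2 hint, ?_⟩
    rw [integral_finsetSum_measure hint]
    simp [integral_smul_measure, ENNReal.toReal_ofReal, hp]

open scoped MatrixOrder in
/-- A positive semidefinite matrix is a sum of squares of vectors, of which all but one are
orthogonal to a given vector. -/
lemma Matrix.PosSemidef.exists_eq_vecMulVec_add_sum {ι : Type*} [Fintype ι] [DecidableEq ι]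
    {M : Matrix ι ι ℝ} (hM : M.PosSemidef) (a : ι → ℝ) :
    ∃ (q : ι → ℝ) (c : ι → ι → ℝ), a ⬝ᵥ q = Real.sqrt (a ⬝ᵥ (M *ᵥ a)) ∧ (∀ k, a ⬝ᵥ c k = 0) ∧
      ∀ i j, M i j = q i * q j + ∑ k, c k i * c k j := by
  obtain ⟨B, rfl⟩ := CStarAlgebra.nonneg_iff_eq_star_mul_self.1 hM.nonneg
  rw [star_eq_conjTranspose]
  set w := B *ᵥ a with hw
  have hwk : ∀ k, a ⬝ᵥ B k = w k := fun k => dotProduct_comm _ _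
  have hV : a ⬝ᵥ ((Bᴴ * B) *ᵥ a) = ∑ k, w k ^ 2 := by
    rw [← mulVec_mulVec, dotProduct_mulVec, conjTranspose_eq_transpose_of_trivial,
      vecMul_transpose, ← hw]
    simp [dotProduct, sq]
  have hBB : ∀ i j, (Bᴴ * B) i j = ∑ k, B k i * B k j := fun i j => by simp [mul_apply]
  rw [hV]
  set σ := Real.sqrt (∑ k, w k ^ 2) with hσ
  have hσ2 : σ ^ 2 = ∑ k, w k ^ 2 := Real.sq_sqrt (Finset.sum_nonneg fun _ _ => sq_nonneg _)
  by_cases h0 : σ = 0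
  · have hw0 : ∀ k, w k = 0 := by
      intro k
      rw [h0] at hσ2
      have := (Finset.sum_eq_zero_iff_of_nonneg (fun i _ => sq_nonneg (w i))).1
        (by rw [← hσ2]; norm_num) k (Finset.mem_univ k)
      simpa using this
    exact ⟨0, B, by simp [h0], fun k => by rw [hwk, hw0], fun i j => by rw [hBB]; simp⟩
  · set q : ι → ℝ := fun i => (∑ k, w k * B k i) / σ with hq
    have hqi : ∀ i, ∑ k, w k * B k i = σ * q i := fun i => by simp only [hq]; field_simp
    have haq : a ⬝ᵥ q = σ := by
      have : σ * (a ⬝ᵥ q) = σ ^ 2 := by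
        rw [hσ2, dotProduct, Finset.mul_sum]
        calc ∑ i, σ * (a i * q i) = ∑ i, ∑ k, w k * (a i * B k i) := by
              refine Finset.sum_congr rfl fun i _ => ?_
              rw [mul_left_comm, ← hqi, Finset.mul_sum]
              exact Finset.sum_congr rfl fun k _ => by ring
          _ = ∑ k, w k ^ 2 := by
              rw [Finset.sum_comm]
              refine Finset.sum_congr rfl fun k _ => ?_
              rw [← Finset.mul_sum, sq]
              congr 1
              exact hwk k
      rw [sq] at this
      exact mul_left_cancel₀ h0 this
    refine ⟨q, fun k => B k - (w k / σ) • q, haq, fun k => ?_, fun i j => ?_⟩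
    · rw [dotProduct_sub, dotProduct_smul, hwk, haq, smul_eq_mul]
      field_simp
      ring
    · have : ∀ k, (B k - (w k / σ) • q) i * (B k - (w k / σ) • q) j =
          B k i * B k j - (q j / σ) * (w k * B k i) - (q i / σ) * (w k * B k j)
            + (q i * q j / σ ^ 2) * w k ^ 2 := fun k => by
        simp only [Pi.sub_apply, Pi.smul_apply, smul_eq_mul]
        field_simp
        ring
      simp only [this, Finset.sum_add_distrib, Finset.sum_sub_distrib, ← Finset.mul_sum, hqi,
        ← hσ2, hBB]
      field_simp
      ring

lemma exists_lt_sqrt_of_lt_sqrt {ε V t : ℝ} (hε : ε ∈ Set.Ioo (0 : ℝ) 1)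
    (h : t < Real.sqrt ((1 - ε) / ε * V)) :
    ∃ e ∈ Set.Ioo ε 1, t < Real.sqrt ((1 - e) / e) * Real.sqrt V := by
  have hc : ContinuousAt (fun e : ℝ => Real.sqrt ((1 - e) / e * V)) ε := by
    have := hε.1.ne'
    fun_prop (disch := assumption)
  have h1 : ∀ᶠ e in nhdsWithin ε (Set.Ioi ε), t < Real.sqrt ((1 - e) / e * V) :=
    (hc.eventually (lt_mem_nhds h)).filter_mono nhdsWithin_le_nhds
  obtain ⟨e, he, he'⟩ := (h1.and (Ioo_mem_nhdsGT hε.2)).exists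
  refine ⟨e, he', ?_⟩
  rwa [Real.sqrt_mul] at he
  exact div_nonneg (by linarith [he'.2]) (by linarith [hε.1, he'.1])

section Moments

variable {n : ℕ} {μ : Fin n → ℝ} {S : Matrix (Fin n) (Fin n) ℝ}

lemma dotProduct_sub_vecMulVec_mulVec (a : Fin n → ℝ) :
    a ⬝ᵥ ((S - vecMulVec μ μ) *ᵥ a) = a ⬝ᵥ (S *ᵥ a) - (a ⬝ᵥ μ) ^ 2 := by
  rw [sub_mulVec, dotProduct_sub, vecMulVec_mulVec]
  simp [dotProduct_smul, dotProduct_comm μ a, sq]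

/-- The second moment of a shifted, centred linear functional. -/
lemma integral_dotProduct_sub_add_sq {P : Measure (Fin n → ℝ)} [IsProbabilityMeasure P]
    (h1 : ∀ i, Integrable (fun ξ => ξ i) P)
    (h2 : ∀ i j, Integrable (fun ξ => ξ i * ξ j) P)
    (hm : ∀ i, (∫ ξ, ξ i ∂P) = μ i) (hs : ∀ i j, (∫ ξ, ξ i * ξ j ∂P) = S i j)
    (a : Fin n → ℝ) (c : ℝ) :
    Integrable (fun ξ => (a ⬝ᵥ ξ - a ⬝ᵥ μ + c) ^ 2) P ∧
      ∫ ξ, (a ⬝ᵥ ξ - a ⬝ᵥ μ + c) ^ 2 ∂P = a ⬝ᵥ ((S - vecMulVec μ μ) *ᵥ a) + c ^ 2 := by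
  set d := c - a ⬝ᵥ μ with hd
  have hexp : (fun ξ : Fin n → ℝ => (a ⬝ᵥ ξ - a ⬝ᵥ μ + c) ^ 2) = fun ξ =>
      ((∑ i, ∑ j, a i * a j * (ξ i * ξ j)) + ∑ i, 2 * d * a i * ξ i) + d ^ 2 := by
    funext ξ
    have e1 : ∑ i, ∑ j, a i * a j * (ξ i * ξ j) = (a ⬝ᵥ ξ) ^ 2 := by
      rw [sq, dotProduct, Finset.sum_mul_sum]
      exact Finset.sum_congr rfl fun i _ => Finset.sum_congr rfl fun j _ => by ring
    have e2 : ∑ i, 2 * d * a i * ξ i = 2 * d * (a ⬝ᵥ ξ) := by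
      rw [dotProduct, Finset.mul_sum]
      exact Finset.sum_congr rfl fun i _ => by ring
    rw [e1, e2, hd]
    ring
  have i1 : ∀ i, Integrable (fun ξ : Fin n → ℝ => ∑ j, a i * a j * (ξ i * ξ j)) P := fun i =>
    integrable_finsetSum _ fun j _ => (h2 i j).const_mul _
  have i1' : Integrable (fun ξ : Fin n → ℝ => ∑ i, ∑ j, a i * a j * (ξ i * ξ j)) P :=
    integrable_finsetSum _ fun i _ => i1 i
  have i2 : Integrable (fun ξ : Fin n → ℝ => ∑ i, 2 * d * a i * ξ i) P :=
    integrable_finsetSum _ fun i _ => (h1 i).const_mul _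
  rw [hexp]
  refine ⟨(i1'.add i2).add (integrable_const _), ?_⟩
  rw [integral_add (by exact i1'.add i2) (integrable_const _), integral_add i1' i2,
    integral_finsetSum _ fun i _ => i1 i,
    integral_finsetSum _ fun i _ => (h1 i).const_mul _]
  have e1 : ∑ i, ∫ ξ, ∑ j, a i * a j * (ξ i * ξ j) ∂P = a ⬝ᵥ (S *ᵥ a) := by
    simp only [dotProduct, mulVec, Finset.mul_sum]
    refine Finset.sum_congr rfl fun i _ => ?_
    rw [integral_finsetSum _ fun j _ => (h2 i j).const_mul _]
    refine Finset.sum_congr rfl fun j _ => ?_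
    rw [integral_const_mul, hs]
    ring
  have e2 : ∑ i, ∫ ξ, 2 * d * a i * ξ i ∂P = 2 * d * (a ⬝ᵥ μ) := by
    rw [dotProduct, Finset.mul_sum]
    refine Finset.sum_congr rfl fun i _ => ?_
    rw [integral_const_mul, hm]
    ring
  rw [e1, e2, dotProduct_sub_vecMulVec_mulVec, hd]
  simp
  ring

/-- One-sided Chebyshev (Cantelli) inequality for a linear functional. -/
lemma ofReal_one_sub_le_measure_of_sqrt_le {P : Measure (Fin n → ℝ)} [IsProbabilityMeasure P]
    (hpsd : (S - vecMulVec μ μ).PosSemidef)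
    (h1 : ∀ i, Integrable (fun ξ => ξ i) P)
    (h2 : ∀ i j, Integrable (fun ξ => ξ i * ξ j) P)
    (hm : ∀ i, (∫ ξ, ξ i ∂P) = μ i) (hs : ∀ i j, (∫ ξ, ξ i * ξ j ∂P) = S i j)
    {ε : ℝ} (hε : ε ∈ Set.Ioo (0 : ℝ) 1) (a : Fin n → ℝ) (b : ℝ)
    (h : Real.sqrt (((1 - ε) / ε) * (a ⬝ᵥ ((S - vecMulVec μ μ) *ᵥ a))) ≤ b - a ⬝ᵥ μ) :
    ENNReal.ofReal (1 - ε) ≤ P {ξ | a ⬝ᵥ ξ ≤ b} := by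
  obtain ⟨hε0, hε1⟩ := hε
  have hmom := integral_dotProduct_sub_add_sq h1 h2 hm hs a
  have hV0 : 0 ≤ a ⬝ᵥ ((S - vecMulVec μ μ) *ᵥ a) := by
    simpa using hpsd.dotProduct_mulVec_nonneg a
  set V := a ⬝ᵥ ((S - vecMulVec μ μ) *ᵥ a) with hV
  have hr : 0 < (1 - ε) / ε := div_pos (by linarith) hε0
  rw [Real.sqrt_mul hr.le] at h
  set κ := Real.sqrt ((1 - ε) / ε) with hκ
  have hκ0 : 0 < κ := Real.sqrt_pos.2 hr
  have hκ2 : κ ^ 2 * ε = 1 - ε := by rw [Real.sq_sqrt hr.le]; field_simp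
  set σ := Real.sqrt V with hσ
  have hσ0 : 0 ≤ σ := Real.sqrt_nonneg _
  have hσ2 : σ ^ 2 = V := Real.sq_sqrt hV0
  rcases hσ0.eq_or_lt with h0 | hpos
  · obtain ⟨hi, he⟩ := hmom 0
    rw [← hσ2, ← h0] at he
    have hae := (integral_eq_zero_iff_of_nonneg (fun ξ => sq_nonneg _) hi).1 (by simpa using he)
    have hone : P {ξ | a ⬝ᵥ ξ ≤ b} = P Set.univ := by
      refine measure_congr (Filter.eventuallyEq_univ.2 ?_)
      filter_upwards [hae] with ξ hξ
      have hz : a ⬝ᵥ ξ - a ⬝ᵥ μ = 0 := by simpa using hξ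
      rw [← h0, mul_zero] at h
      change a ⬝ᵥ ξ ≤ b
      linarith
    rw [hone, measure_univ]
    exact ENNReal.ofReal_le_one.2 (by linarith)
  · obtain ⟨hi, he⟩ := hmom (σ / κ)
    have hmarkov := mul_meas_ge_le_integral_of_nonneg
      (Filter.Eventually.of_forall fun ξ => sq_nonneg (a ⬝ᵥ ξ - a ⬝ᵥ μ + σ / κ)) hi
      ((κ * σ + σ / κ) ^ 2)
    rw [he, ← hσ2] at hmarkov
    have hval : σ ^ 2 + (σ / κ) ^ 2 = (κ * σ + σ / κ) ^ 2 * ε := by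
      have : ε = 1 / (κ ^ 2 + 1) := by
        rw [eq_div_iff (by positivity)]; linarith
      rw [this]
      field_simp
    rw [hval] at hmarkov
    have hle := le_of_mul_le_mul_left hmarkov (by positivity)
    have hmeas : MeasurableSet {ξ : Fin n → ℝ | a ⬝ᵥ ξ ≤ b} :=
      measurableSet_le (by unfold dotProduct; fun_prop) measurable_const
    have hsub : {ξ : Fin n → ℝ | a ⬝ᵥ ξ ≤ b}ᶜ ⊆
        {ξ | (κ * σ + σ / κ) ^ 2 ≤ (a ⬝ᵥ ξ - a ⬝ᵥ μ + σ / κ) ^ 2} := by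
      intro ξ hξ
      simp only [Set.mem_compl_iff, Set.mem_ofPred_eq, not_le] at hξ ⊢
      gcongr
      linarith
    have hc : P.real {ξ : Fin n → ℝ | a ⬝ᵥ ξ ≤ b}ᶜ ≤ ε := (measureReal_mono hsub).trans hle
    rw [probReal_compl_eq_one_sub hmeas] at hc
    rw [← ofReal_measureReal]
    exact ENNReal.ofReal_le_ofReal (by linarith)

/-- A probability measure with prescribed first two moments putting mass at least `e` on the
half-space beyond `√((1 - e) / e)` standard deviations. -/
lemma exists_isProbabilityMeasure_measure_le (hn : 1 ≤ n)
    (hpsd : (S - vecMulVec μ μ).PosSemidef) {e : ℝ} (he : e ∈ Set.Ioo (0 : ℝ) 1)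
    (a : Fin n → ℝ) (b : ℝ)
    (h : b - a ⬝ᵥ μ <
      Real.sqrt ((1 - e) / e) * Real.sqrt (a ⬝ᵥ ((S - vecMulVec μ μ) *ᵥ a))) :
    ∃ P : Measure (Fin n → ℝ), IsProbabilityMeasure P ∧
      (∀ i, Integrable (fun ξ => ξ i) P) ∧
      (∀ i j, Integrable (fun ξ => ξ i * ξ j) P) ∧
      (∀ i, (∫ ξ, ξ i ∂P) = μ i) ∧
      (∀ i j, (∫ ξ, ξ i * ξ j ∂P) = S i j) ∧
      P {ξ | a ⬝ᵥ ξ ≤ b} ≤ ENNReal.ofReal (1 - e) := by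
  obtain ⟨he0, he1⟩ := he
  obtain ⟨q, c, hq, hc, hM⟩ := hpsd.exists_eq_vecMulVec_add_sum a
  rw [← hq] at h
  have hr : 0 < (1 - e) / e := div_pos (by linarith) he0
  set κ := Real.sqrt ((1 - e) / e) with hκ
  have hκ0 : 0 < κ := Real.sqrt_pos.2 hr
  have hκ2 : κ ^ 2 = (1 - e) / e := Real.sq_sqrt hr.le
  have hn0 : (0 : ℝ) < n := by exact_mod_cast hn
  set r := Real.sqrt n with hrn
  have hr2 : r ^ 2 = n := Real.sq_sqrt hn0.le
  obtain ⟨P, hP, hf⟩ := exists_isProbabilityMeasure_integral_eq_sum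
    (ι := Bool × Fin n × Bool) (α := Fin n → ℝ)
    (fun t => (if t.1 then e else 1 - e) * (1 / (2 * n)))
    (fun t => mul_nonneg (by split_ifs <;> linarith) (by positivity))
    (by
      simp [Fintype.sum_prod_type]
      field_simp
      ring)
    (fun t => μ + (if t.1 then κ else -κ⁻¹) • q + (if t.2.2 then r else -r) • c t.2.1)
  have hmean : e * κ - (1 - e) * κ⁻¹ = 0 := by
    have : e * κ ^ 2 = 1 - e := by rw [hκ2]; field_simp
    field_simp
    linarith
  have hvar : e * κ ^ 2 + (1 - e) * (κ⁻¹) ^ 2 = 1 := by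
    rw [inv_pow, hκ2]
    have : 1 - e ≠ 0 := by linarith
    field_simp
    ring
  refine ⟨P, hP, fun i => (hf _).1, fun i j => (hf _).1, fun i => ?_, fun i j => ?_, ?_⟩
  · rw [(hf _).2]
    have hsum : ∀ k : Fin n, (e * (1 / (2 * n)) * (μ i + κ * q i + r * c k i)
        + e * (1 / (2 * n)) * (μ i + κ * q i + -r * c k i))
        + ((1 - e) * (1 / (2 * n)) * (μ i + -κ⁻¹ * q i + r * c k i)
        + (1 - e) * (1 / (2 * n)) * (μ i + -κ⁻¹ * q i + -r * c k i)) = 1 / n * μ i := fun k => by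
      linear_combination (1 / n * q i) * hmean
    simp only [Fintype.sum_prod_type, Fintype.sum_bool, Pi.add_apply, Pi.smul_apply, smul_eq_mul,
      if_true, Bool.false_eq_true, if_false, ← Finset.sum_add_distrib, hsum]
    simp
    field_simp
  · rw [(hf _).2]
    have hsum : ∀ k : Fin n,
        (e * (1 / (2 * n)) * ((μ i + κ * q i + r * c k i) * (μ j + κ * q j + r * c k j))
        + e * (1 / (2 * n)) * ((μ i + κ * q i + -r * c k i) * (μ j + κ * q j + -r * c k j)))
        + ((1 - e) * (1 / (2 * n)) *
            ((μ i + -κ⁻¹ * q i + r * c k i) * (μ j + -κ⁻¹ * q j + r * c k j))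
        + (1 - e) * (1 / (2 * n)) *
            ((μ i + -κ⁻¹ * q i + -r * c k i) * (μ j + -κ⁻¹ * q j + -r * c k j)))
        = 1 / n * (μ i * μ j + q i * q j) + c k i * c k j := fun k => by
      have hnn : (1 / n : ℝ) * n = 1 := by field_simp
      linear_combination (1 / n * (μ i * q j + q i * μ j)) * hmean + (1 / n * (q i * q j)) * hvar
        + (1 / n * c k i * c k j) * hr2 + (c k i * c k j) * hnn
    simp only [Fintype.sum_prod_type, Fintype.sum_bool, Pi.add_apply, Pi.smul_apply, smul_eq_mul,
      if_true, Bool.false_eq_true, if_false, ← Finset.sum_add_distrib, hsum]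
    have hMij := hM i j
    rw [Matrix.sub_apply, vecMulVec_apply] at hMij
    rw [Finset.sum_add_distrib, Finset.sum_const, Finset.card_univ, Fintype.card_fin, nsmul_eq_mul]
    have hnn : (n : ℝ) * (1 / n) = 1 := by field_simp
    linear_combination (μ i * μ j + q i * q j) * hnn - hMij
  · have hmeas : MeasurableSet {ξ : Fin n → ℝ | a ⬝ᵥ ξ ≤ b} :=
      measurableSet_le (by unfold dotProduct; fun_prop) measurable_const
    rw [← ofReal_measureReal]
    refine ENNReal.ofReal_le_ofReal ?_
    rw [← integral_indicator_one hmeas, (hf _).2]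
    have hle : ∀ t : Bool × Fin n × Bool,
        (if t.1 then e else 1 - e) * (1 / (2 * n)) *
          ({ξ : Fin n → ℝ | a ⬝ᵥ ξ ≤ b}.indicator 1 (μ + (if t.1 then κ else -κ⁻¹) • q
            + (if t.2.2 then r else -r) • c t.2.1) : ℝ) ≤
        (if t.1 then 0 else 1 - e) * (1 / (2 * n)) := by
      rintro ⟨s, k, s'⟩
      cases s
      · simp only [Bool.false_eq_true, if_false]
        refine mul_le_of_le_one_right (mul_nonneg (by linarith) (by positivity)) ?_
        exact Set.indicator_le_self' (fun _ _ => zero_le_one) _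
      · rw [Set.indicator_of_notMem]
        · simp
        · simp only [if_true, Set.mem_ofPred_eq, not_le, dotProduct_add, dotProduct_smul, hc,
            smul_eq_mul]
          linarith
    refine (Finset.sum_le_sum fun t _ => hle t).trans_eq ?_
    simp [Fintype.sum_prod_type]
    field_simp
    norm_num

end Moments

theorem stmt0 (n : ℕ) (hn : 1 ≤ n) (μ : Fin n → ℝ) (S : Matrix (Fin n) (Fin n) ℝ)
    (hS : S.IsSymm) (hpsd : (S - vecMulVec μ μ).PosSemidef)
    (ε : ℝ) (hε : ε ∈ Set.Ioo (0 : ℝ) 1) (a : Fin n → ℝ) (b : ℝ) :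
    (∀ P : Measure (Fin n → ℝ), IsProbabilityMeasure P →
      (∀ i, Integrable (fun ξ => ξ i) P) →
      (∀ i j, Integrable (fun ξ => ξ i * ξ j) P) →
      (∀ i, (∫ ξ, ξ i ∂P) = μ i) →
      (∀ i j, (∫ ξ, ξ i * ξ j ∂P) = S i j) →
      ENNReal.ofReal (1 - ε) ≤ P {ξ | a ⬝ᵥ ξ ≤ b}) ↔
    Real.sqrt (((1 - ε) / ε) * (a ⬝ᵥ ((S - vecMulVec μ μ) *ᵥ a))) ≤ b - a ⬝ᵥ μ := by
  refine ⟨fun H => ?_, fun h P _ h1 h2 hm hs =>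
    ofReal_one_sub_le_measure_of_sqrt_le hpsd h1 h2 hm hs hε a b h⟩
  by_contra! hlt
  obtain ⟨e, he, hlt'⟩ := exists_lt_sqrt_of_lt_sqrt hε hlt
  obtain ⟨P, hP, h1, h2, hm, hs, hle⟩ :=
    exists_isProbabilityMeasure_measure_le hn hpsd ⟨hε.1.trans he.1, he.2⟩ a b hlt'
  have := (ENNReal.ofReal_le_ofReal_iff (by linarith [he.2])).1
    ((H P hP h1 h2 hm hs).trans hle)
  linarith [he.1]
end

section
/- Let n ≥ 1, α ≥ 1, ε ∈ (0, 1/2), μ ∈ ℝⁿ, Σ a symmetric n×n real matrix, m_t ∈ ℝⁿ, a ∈ ℝⁿ, b ∈ ℝ. Assume ((α+2)/α)(Σ − μμᵀ) − (1/α²)(μ − m_t)(μ − m_t)ᵀ is positive definite, and assume aᵀm_t ≤ b. Let Λ_t be the positive semidefinite square root of ((α+2)/α)(Σ − μμᵀ) − (1/α²)(μ − m_t)(μ − m_t)ᵀ. Then every Borel probability distribution P on ℝⁿ that is α-unimodal with mode m_t, has mean μ and second moment matrix Σ satisfies P({ξ : aᵀξ ≤ b}) ≥ 1 − ε, if and only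 if for every τ ≥ (1/(1−ε))^{1/α}: √((1−ε−τ^{−α})/ε)·‖Λ_t a‖ ≤ τ(b − μᵀa) + (τ − (α+1)/α)·(μ − m_t)ᵀa. -/
open MeasureTheory Matrix Pointwise

/-- A Borel probability distribution `P` on `ℝⁿ` is `α`-unimodal with mode `m` if the
pushforward of `P` under `x ↦ x - m` is `α`-unimodal with mode `0`, i.e. for every Borel set
`B` the map `t ↦ t^α * P((1/t) • B)` is nondecreasing on `t > 0`. -/
def AlphaUnimodal {n : ℕ} (α : ℝ) (m : Fin n → ℝ) (P : Measure (Fin n → ℝ)) : Prop :=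
  ∀ B : Set (Fin n → ℝ), MeasurableSet B →
    MonotoneOn (fun t : ℝ => t ^ α * ((P.map (fun x => x - m)) ((1 / t) • B)).toReal)
      (Set.Ioi (0 : ℝ))

/-- One-sided Chebyshev bound combined with Jensen's inequality. -/
lemma exists_tail_bound {Q : Measure ℝ} [IsProbabilityMeasure Q]
    (h1 : Integrable (fun z => z) Q) (h2 : Integrable (fun z => z ^ 2) Q)
    {α c k q : ℝ} (hα : 0 < α) (hc : 0 ≤ c) (hk : 0 ≤ k) (hk1 : k ≤ 1) (hq : 0 < q)
    (hQ : q ≤ ∫ z, (Set.Ioi c).indicator (fun z => 1 - k * (c / z) ^ α) z ∂Q) :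
    ∃ p W : ℝ, q ≤ p ∧ p ≤ 1 ∧
      W = (∫ z, z ∂Q) + √(((∫ z, z ^ 2 ∂Q) - (∫ z, z ∂Q) ^ 2) * ((1 - p) / p)) ∧
      c < W ∧ q ≤ p * (1 - k * (c / W) ^ α) := by
  set ν := ∫ z, z ∂Q with hν
  set m2 := ∫ z, z ^ 2 ∂Q with hm2
  set p := Q.real (Set.Ioi c) with hp
  set A := ∫ z in Set.Ioi c, z ∂Q with hA
  have hmeas : MeasurableSet (Set.Ioi c) := measurableSet_Ioi
  have hp1 : p ≤ 1 := measureReal_le_one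
  have hbd : ∀ z ∈ Set.Ioi c, 0 ≤ k * (c / z) ^ α ∧ k * (c / z) ^ α ≤ 1 := by
    intro z hz
    have hz0 : 0 < z := lt_of_le_of_lt hc hz
    have h0 : 0 ≤ c / z := by positivity
    have h1 : c / z ≤ 1 := by rw [div_le_one hz0]; exact le_of_lt hz
    have := Real.rpow_le_one h0 h1 hα.le
    have h3 := Real.rpow_nonneg h0 α
    exact ⟨by positivity, by nlinarith⟩
  have hInt : IntegrableOn (fun z => 1 - k * (c / z) ^ α) (Set.Ioi c) Q := by
    refine Measure.integrableOn_of_bounded (M := 1) (measure_ne_top _ _) ?_ ?_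
    · exact (by fun_prop : Measurable fun z : ℝ => 1 - k * (c / z) ^ α).aestronglyMeasurable
    · refine (ae_restrict_iff' hmeas).2 (Filter.Eventually.of_forall fun z hz => ?_)
      obtain ⟨h, h'⟩ := hbd z hz
      rw [Real.norm_eq_abs, abs_le]
      constructor <;> linarith
  rw [integral_indicator hmeas] at hQ
  have hqp : q ≤ p := by
    refine hQ.trans ?_
    calc _ ≤ ∫ z in Set.Ioi c, (1 : ℝ) ∂Q :=
          setIntegral_mono_on hInt (integrable_const _) hmeas fun z hz => by
            linarith [(hbd z hz).1]
      _ = p := by simp [hp]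
  have hp0 : 0 < p := hq.trans_le hqp
  -- the conditional mean exceeds the threshold
  have hcA : c * p < A := by
    have hpos : 0 < ∫ z in Set.Ioi c, (z - c) ∂Q := by
      rw [setIntegral_pos_iff_support_of_nonneg_ae]
      · have : Function.support (fun z => z - c) ∩ Set.Ioi c = Set.Ioi c := by
          ext z
          simp only [Set.mem_inter_iff, Function.mem_support, Set.mem_Ioi,
            and_iff_right_iff_imp]
          exact fun h => (sub_pos.2 h).ne'
        rw [this]
        rw [hp, measureReal_def] at hp0
        exact (ENNReal.toReal_pos_iff.1 hp0).1
      · refine (ae_restrict_iff' hmeas).2 (Filter.Eventually.of_forall fun z hz => ?_)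
        exact (sub_pos.2 hz).le
      · exact (h1.sub (integrable_const c)).integrableOn
    rw [integral_sub h1.integrableOn (integrable_const _)] at hpos
    simp only [integral_const, smul_eq_mul, measureReal_restrict_apply_univ] at hpos
    linarith
  set w := A / p with hw
  have hAw : A = w * p := by rw [hw]; field_simp
  have hcw : c < w := by rw [hw, lt_div_iff₀ hp0]; exact hcA
  have hw0 : 0 < w := hc.trans_lt hcw
  have hjensen : q ≤ p * (1 - k * (c / w) ^ α) := by
    refine hQ.trans ?_
    have key : ∀ z ∈ Set.Ioi c, 1 - k * (c / z) ^ α ≤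
        1 - k * (c / w) ^ α * (1 + α) + k * (c / w) ^ α * α / w * z := by
      intro z hz
      have hz0 : 0 < z := lt_of_le_of_lt hc hz
      have e1 : (c / z) ^ α = (c / w) ^ α * (w / z) ^ α := by
        rw [← Real.mul_rpow (by positivity) (by positivity)]
        congr 1; field_simp
      have e2 : 1 - α * (z / w - 1) ≤ (w / z) ^ α := by
        rw [Real.rpow_def_of_pos (by positivity)]
        have l1 := Real.log_le_sub_one_of_pos (show 0 < z / w by positivity)
        have l2 : Real.log (w / z) = - Real.log (z / w) := by
          rw [← Real.log_inv, inv_div]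
        have l3 := Real.add_one_le_exp (Real.log (w / z) * α)
        rw [l2] at l3 ⊢
        nlinarith
      have e3 : 0 ≤ k * (c / w) ^ α := by positivity
      rw [e1]
      have := mul_le_mul_of_nonneg_left e2 e3
      have e4 : k * (c / w) ^ α * α / w * z = k * (c / w) ^ α * (α * (z / w)) := by ring
      rw [e4]; nlinarith
    have hz' : IntegrableOn (fun z => k * (c / w) ^ α * α / w * z) (Set.Ioi c) Q :=
      (h1.const_mul _).integrableOn
    refine (setIntegral_mono_on hInt
      (g := fun z => 1 - k * (c / w) ^ α * (1 + α) + k * (c / w) ^ α * α / w * z)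
      ((integrable_const _).add hz') hmeas key).trans ?_
    rw [integral_add (integrable_const _) hz', integral_const_mul, ← hA, hAw]
    simp only [integral_const, smul_eq_mul, measureReal_restrict_apply_univ]
    rw [← hp]
    apply le_of_eq
    field_simp
    ring
  have hcheb : p * (w - ν) ^ 2 ≤ (1 - p) * (m2 - ν ^ 2) := by
    set I : ℝ → ℝ := (Set.Ioi c).indicator (fun _ => 1) with hI
    have hII : ∀ z, I z ^ 2 = I z := by
      intro z; by_cases h : z ∈ Set.Ioi c <;> simp [hI, h]
    have iI : Integrable I Q := (integrable_const (1 : ℝ)).indicator hmeas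
    have izI' : (fun z => z * I z) = (Set.Ioi c).indicator (fun z => z) := by
      ext z; by_cases h : z ∈ Set.Ioi c <;> simp [hI, h]
    have izI : Integrable (fun z => z * I z) Q := by
      rw [izI']; exact h1.indicator hmeas
    have vI : ∫ z, I z ∂Q = p := by
      rw [hI, integral_indicator hmeas]; simp [hp]
    have vzI : ∫ z, z * I z ∂Q = w * p := by
      rw [izI', integral_indicator hmeas, ← hAw]
    have quad : ∀ x : ℝ, 0 ≤ (p * (1 - p)) * (x * x) + (-2 * (p * (w - ν))) * x
        + (m2 - ν ^ 2) := by
      intro x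
      have h0 : 0 ≤ ∫ z, ((z - ν) - x * (I z - p)) ^ 2 ∂Q :=
        integral_nonneg fun z => sq_nonneg _
      have e : ∀ z, ((z - ν) - x * (I z - p)) ^ 2 =
          z ^ 2 + (-2 * ν + 2 * x * p) * z + (-2 * x) * (z * I z) +
          (2 * x * ν + x ^ 2 - 2 * x ^ 2 * p) * I z + (ν ^ 2 - 2 * ν * x * p + x ^ 2 * p ^ 2) := by
        intro z
        linear_combination x ^ 2 * hII z
      simp_rw [e] at h0
      have j1 := h1.const_mul (-2 * ν + 2 * x * p)
      have j2 := izI.const_mul (-2 * x)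
      have j3 := iI.const_mul (2 * x * ν + x ^ 2 - 2 * x ^ 2 * p)
      have j12 := h2.fun_add j1
      have j123 := j12.fun_add j2
      have j := j123.fun_add j3
      rw [integral_add j (integrable_const _), integral_add j123 j3, integral_add j12 j2,
        integral_add h2 j1,
        integral_const_mul, integral_const_mul, integral_const_mul, vI, vzI, ← hν, ← hm2] at h0
      simp only [integral_const, smul_eq_mul, probReal_univ] at h0
      nlinarith
    have hd := discrim_le_zero quad
    rw [discrim] at hd
    have : p * (p * (w - ν) ^ 2) ≤ p * ((1 - p) * (m2 - ν ^ 2)) := by nlinarith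
    exact le_of_mul_le_mul_left this hp0
  have hwW : w ≤ ν + √((m2 - ν ^ 2) * ((1 - p) / p)) := by
    have : (w - ν) ^ 2 ≤ (m2 - ν ^ 2) * ((1 - p) / p) := by
      rw [mul_div_assoc', le_div_iff₀ hp0]; linarith
    have := (le_abs_self _).trans (Real.abs_le_sqrt this)
    linarith
  refine ⟨p, _, hqp, hp1, rfl, hcw.trans_le hwW, hjensen.trans ?_⟩
  have hW0 : 0 < ν + √((m2 - ν ^ 2) * ((1 - p) / p)) := hw0.trans_le hwW
  gcongr

/-- The mixing measure of `ρ` at scale `s`. -/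
lemma exists_scale_mixing {ρ : Measure ℝ} [IsProbabilityMeasure ρ] {s κ : ℝ}
    (hκ : κ ∈ Set.Ioo (0 : ℝ) 1)
    (hR : ENNReal.ofReal κ • ρ.map (fun x => s * x) ≤ ρ) :
    ∃ Q : Measure ℝ, IsProbabilityMeasure Q ∧ ∀ g : ℝ → ℝ, Measurable g → Integrable g ρ →
      Integrable g Q ∧ ∫ z, g z ∂Q = (∫ y, g y ∂ρ - κ * ∫ y, g (s * y) ∂ρ) / (1 - κ) := by
  obtain ⟨h0, h1⟩ := hκ
  have hs : Measurable (fun x : ℝ => s * x) := by fun_prop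
  set K := ENNReal.ofReal κ • ρ.map (fun x => s * x) with hK
  have : IsProbabilityMeasure (ρ.map (fun x => s * x)) :=
    Measure.isProbabilityMeasure_map hs.aemeasurable
  have hfin : IsFiniteMeasure K := ⟨(hR _).trans_lt (measure_lt_top _ _)⟩
  have hadd : ρ - K + K = ρ := Measure.sub_add_cancel_of_le hR
  have hle : ρ - K ≤ ρ := Measure.sub_le
  have hd : 0 < 1 - κ := by linarith
  refine ⟨ENNReal.ofReal (1 - κ)⁻¹ • (ρ - K), ⟨?_⟩, fun g hg hgR => ?_⟩
  · have hu : (ρ - K) Set.univ = ENNReal.ofReal (1 - κ) := by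
      rw [Measure.sub_apply MeasurableSet.univ hR, hK]
      simp only [measure_univ, Measure.smul_apply, smul_eq_mul, mul_one]
      rw [ENNReal.ofReal_sub _ h0.le, ENNReal.ofReal_one]
    rw [Measure.smul_apply, hu, smul_eq_mul, ← ENNReal.ofReal_mul (by positivity),
      inv_mul_cancel₀ hd.ne', ENNReal.ofReal_one]
  · have i1 : Integrable g (ρ - K) := hgR.mono_measure hle
    have i2 : Integrable g K := hgR.mono_measure hR
    refine ⟨i1.smul_measure ENNReal.ofReal_ne_top, ?_⟩
    have e : ∫ y, g y ∂ρ = ∫ y, g y ∂(ρ - K) + ∫ y, g y ∂K := by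
      conv_lhs => rw [← hadd]
      exact integral_add_measure i1 i2
    have e2 : ∫ y, g y ∂K = κ * ∫ y, g (s * y) ∂ρ := by
      rw [hK, integral_smul_measure, integral_map hs.aemeasurable hg.aestronglyMeasurable,
        ENNReal.toReal_ofReal h0.le, smul_eq_mul]
    rw [integral_smul_measure, ENNReal.toReal_ofReal (by positivity), smul_eq_mul, e, e2]
    field_simp
    ring

lemma exists_tail_bound_of_scale {ρ : Measure ℝ} [IsProbabilityMeasure ρ]
    (h1 : Integrable (fun z => z) ρ) (h2 : Integrable (fun z => z ^ 2) ρ)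
    {α c s : ℝ} (hα : 0 < α) (hc : 0 ≤ c) (hs : s ∈ Set.Ioo (0 : ℝ) 1)
    (hR : ENNReal.ofReal (s ^ α) • ρ.map (fun x => s * x) ≤ ρ)
    (hq : 0 < ρ.real (Set.Ioi c)) :
    ∃ p W : ℝ, ρ.real (Set.Ioi c) ≤ p ∧ p ≤ 1 ∧
      W = (∫ z, z ∂ρ) * ((1 - s ^ (α + 1)) / (1 - s ^ α)) +
        √(((∫ z, z ^ 2 ∂ρ) * ((1 - s ^ (α + 2)) / (1 - s ^ α)) -
          ((∫ z, z ∂ρ) * ((1 - s ^ (α + 1)) / (1 - s ^ α))) ^ 2) * ((1 - p) / p)) ∧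
      c < W ∧ ρ.real (Set.Ioi c) ≤ p * (1 - s ^ α * (c / W) ^ α) := by
  obtain ⟨hs0, hs1⟩ := hs
  have hκ : s ^ α ∈ Set.Ioo (0 : ℝ) 1 :=
    ⟨by positivity, Real.rpow_lt_one hs0.le hs1 hα⟩
  obtain ⟨Q, hQ, hInt⟩ := exists_scale_mixing hκ hR
  have hmeas : MeasurableSet (Set.Ioi c) := measurableSet_Ioi
  have hd : 0 < 1 - s ^ α := by linarith [hκ.2]
  have e1 : ∫ z, z ∂Q = (∫ z, z ∂ρ) * ((1 - s ^ (α + 1)) / (1 - s ^ α)) := by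
    rw [(hInt (fun z => z) measurable_id h1).2]
    have : ∫ y, s * y ∂ρ = s * ∫ y, y ∂ρ := integral_const_mul _ _
    rw [this]
    rw [Real.rpow_add hs0, Real.rpow_one]; ring
  have e2 : ∫ z, z ^ 2 ∂Q = (∫ z, z ^ 2 ∂ρ) * ((1 - s ^ (α + 2)) / (1 - s ^ α)) := by
    rw [(hInt _ (by fun_prop) h2).2]
    simp only [mul_pow, integral_const_mul]
    rw [Real.rpow_add hs0, Real.rpow_ofNat]; ring
  rw [← e1, ← e2]
  refine exists_tail_bound (hInt (fun z => z) measurable_id h1).1 (hInt _ (by fun_prop) h2).1 hα hc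
    hκ.1.le hκ.2.le hq ?_
  set h : ℝ → ℝ := (Set.Ioi c).indicator (fun z => 1 - s ^ α * (c / z) ^ α) with hh
  have hhm : Measurable h :=
    (by fun_prop : Measurable fun z : ℝ => 1 - s ^ α * (c / z) ^ α).indicator hmeas
  have hval : ∀ y, c < y → h y = 1 - s ^ α * (c / y) ^ α := fun y hy => by
    rw [hh, Set.indicator_of_mem (Set.mem_Ioi.2 hy)]
  have hval' : ∀ y, y ≤ c → h y = 0 := fun y hy => by
    rw [hh, Set.indicator_of_notMem (by simpa using hy)]
  have hrp : ∀ y, c < y → 0 ≤ (c / y) ^ α ∧ (c / y) ^ α ≤ 1 := by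
    intro y hy
    have hy0 : 0 < y := hc.trans_lt hy
    exact ⟨by positivity, Real.rpow_le_one (by positivity) ((div_le_one hy0).2 hy.le) hα.le⟩
  have hb : ∀ y, ‖h y‖ ≤ 1 := by
    intro y
    rcases lt_or_ge c y with hy | hy
    · obtain ⟨a1, a2⟩ := hrp y hy
      rw [hval y hy, Real.norm_eq_abs, abs_le]
      constructor <;> nlinarith [hκ.1, hκ.2]
    · simp [hval' y hy]
  have hI : Integrable h ρ := Integrable.of_bound hhm.aestronglyMeasurable 1
    (Filter.Eventually.of_forall hb)
  have hIs : Integrable (fun y => h (s * y)) ρ :=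
    Integrable.of_bound (hhm.comp (by fun_prop)).aestronglyMeasurable 1
      (Filter.Eventually.of_forall fun y => hb _)
  rw [(hInt h hhm hI).2, le_div_iff₀ hd, ← integral_const_mul,
    ← integral_sub hI (hIs.const_mul _)]
  have : ρ.real (Set.Ioi c) * (1 - s ^ α) =
      ∫ y, (Set.Ioi c).indicator (fun _ => 1 - s ^ α) y ∂ρ := by
    rw [integral_indicator hmeas]; simp
  rw [this]
  refine integral_mono ((integrable_const _).indicator hmeas) (hI.sub (hIs.const_mul _)) ?_
  intro y
  dsimp only
  rcases lt_or_ge c y with hy | hy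
  · have hy0 : 0 < y := hc.trans_lt hy
    rw [Set.indicator_of_mem (Set.mem_Ioi.2 hy), hval y hy]
    rcases lt_or_ge c (s * y) with hsy | hsy
    · rw [hval _ hsy]
      have : s ^ α * (c / (s * y)) ^ α = (c / y) ^ α := by
        rw [← Real.mul_rpow hs0.le (by positivity)]
        congr 1; field_simp
      rw [this]; apply le_of_eq; ring
    · rw [hval' _ hsy]
      nlinarith [hrp y hy, hκ.1]
  · have : s * y ≤ c := by
      rcases le_or_gt y 0 with h | h
      · nlinarith
      · nlinarith
    rw [Set.indicator_of_notMem (by simpa using hy), hval' y hy, hval' _ this]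
    simp

lemma tendsto_one_sub_rpow_div {α β : ℝ} (hα : α ≠ 0) {s : ℕ → ℝ}
    (hs : Filter.Tendsto s Filter.atTop (nhds 1)) (hs1 : ∀ k, s k < 1) :
    Filter.Tendsto (fun k => (1 - s k ^ β) / (1 - s k ^ α)) Filter.atTop (nhds (β / α)) := by
  have hs' : Filter.Tendsto s Filter.atTop (nhdsWithin 1 {1}ᶜ) :=
    tendsto_nhdsWithin_iff.2 ⟨hs, Filter.Eventually.of_forall fun k => (hs1 k).ne⟩
  have key : ∀ q : ℝ, Filter.Tendsto (fun k => slope (fun x : ℝ => x ^ q) 1 (s k))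
      Filter.atTop (nhds q) := by
    intro q
    have h := Real.hasDerivAt_rpow_const (x := 1) (p := q) (Or.inl one_ne_zero)
    rw [Real.one_rpow, mul_one] at h
    exact (hasDerivAt_iff_tendsto_slope.1 h).comp hs'
  refine ((key β).div (key α) hα).congr fun k => ?_
  have : s k - 1 ≠ 0 := (sub_neg.2 (hs1 k)).ne
  simp only [Pi.div_apply, slope_def_field, Real.one_rpow]
  rw [div_div_div_cancel_right₀ this, ← neg_sub, ← neg_sub 1 (s k ^ α), neg_div_neg_eq]

lemma exists_tail_bound_of_forall_scale {ρ : Measure ℝ} [IsProbabilityMeasure ρ]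
    (h1 : Integrable (fun z => z) ρ) (h2 : Integrable (fun z => z ^ 2) ρ)
    {α c : ℝ} (hα : 0 < α) (hc : 0 ≤ c)
    (hR : ∀ s ∈ Set.Ioo (0 : ℝ) 1, ENNReal.ofReal (s ^ α) • ρ.map (fun x => s * x) ≤ ρ)
    (hq : 0 < ρ.real (Set.Ioi c)) :
    ∃ p W : ℝ, ρ.real (Set.Ioi c) ≤ p ∧ p ≤ 1 ∧
      W = (∫ z, z ∂ρ) * ((α + 1) / α) +
        √(((∫ z, z ^ 2 ∂ρ) * ((α + 2) / α) -
          ((∫ z, z ∂ρ) * ((α + 1) / α)) ^ 2) * ((1 - p) / p)) ∧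
      c ≤ W ∧ (0 < c → ρ.real (Set.Ioi c) ≤ p * (1 - (c / W) ^ α)) := by
  have ht : Filter.Tendsto (fun k : ℕ => 1 - 1 / ((k : ℝ) + 1)) Filter.atTop (nhds 1) := by
    simpa using tendsto_one_div_add_atTop_nhds_zero_nat.const_sub (1 : ℝ)
  set s : ℕ → ℝ := fun k => 1 - 1 / (((k + 1 : ℕ) : ℝ) + 1) with hsdef
  have hs : Filter.Tendsto s Filter.atTop (nhds 1) := ht.comp (Filter.tendsto_add_atTop_nat 1)
  have hs01 : ∀ k, s k ∈ Set.Ioo (0 : ℝ) 1 := by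
    intro k
    have h1 : 1 / (((k + 1 : ℕ) : ℝ) + 1) < 1 := by
      rw [div_lt_one (by positivity)]; push_cast; linarith [(Nat.cast_nonneg k : (0 : ℝ) ≤ k)]
    have h2 : 0 < 1 / (((k + 1 : ℕ) : ℝ) + 1) := by positivity
    constructor <;> simp only [hsdef] <;> linarith
  choose p W hqp hp1 hW hcW hqW using fun k =>
    exists_tail_bound_of_scale h1 h2 hα hc (hs01 k) (hR _ (hs01 k)) hq
  obtain ⟨r, hr, φ, hφ, hlim⟩ := isCompact_Icc.tendsto_subseq
    (fun k => (⟨hqp k, hp1 k⟩ : p k ∈ Set.Icc (ρ.real (Set.Ioi c)) 1))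
  have hr0 : r ≠ 0 := (hq.trans_le hr.1).ne'
  have hsφ := hs.comp hφ.tendsto_atTop
  have hsφ1 : ∀ k, (s ∘ φ) k < 1 := fun k => (hs01 _).2
  have t1 := (tendsto_one_sub_rpow_div (β := α + 1) hα.ne' hsφ hsφ1).const_mul (∫ z, z ∂ρ)
  have t2 := (tendsto_one_sub_rpow_div (β := α + 2) hα.ne' hsφ hsφ1).const_mul (∫ z, z ^ 2 ∂ρ)
  have tp : Filter.Tendsto (fun k => (1 - (p ∘ φ) k) / (p ∘ φ) k) Filter.atTop
      (nhds ((1 - r) / r)) := (hlim.const_sub 1).div hlim hr0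
  have tW := t1.add ((Real.continuous_sqrt.tendsto _).comp ((t2.sub (t1.pow 2)).mul tp))
  have tW' : Filter.Tendsto (fun k => W (φ k)) Filter.atTop (nhds
      ((∫ z, z ∂ρ) * ((α + 1) / α) +
        √(((∫ z, z ^ 2 ∂ρ) * ((α + 2) / α) -
          ((∫ z, z ∂ρ) * ((α + 1) / α)) ^ 2) * ((1 - r) / r)))) :=
    tW.congr fun k => (hW (φ k)).symm
  have hcW' := ge_of_tendsto' tW' fun k => (hcW (φ k)).le
  refine ⟨r, _, hr.1, hr.2, rfl, hcW', fun hc0 => ?_⟩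
  have hsα : Filter.Tendsto (fun k => (s ∘ φ) k ^ α) Filter.atTop (nhds 1) := by
    simpa using hsφ.rpow_const (p := α) (Or.inl one_ne_zero)
  have tcW := ((tendsto_const_nhds (x := c)).div tW' (hc0.trans_le hcW').ne').rpow_const (p := α) (Or.inr hα.le)
  have := ge_of_tendsto' (hlim.mul ((hsα.mul tcW).const_sub 1)) fun k => hqW (φ k)
  simpa using this

lemma no_violation {α ε ν v c p W q : ℝ} (hα : 0 < α) (hε : 0 < ε) (hv : 0 < v)
    (hc : 0 ≤ c)
    (H : ∀ τ : ℝ, (1 / (1 - ε)) ^ (1 / α) ≤ τ →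
      √((1 - ε - τ ^ (-α)) / ε) * √v ≤ τ * c - ν)
    (hεq : ε < q) (hqp : q ≤ p) (hp1 : p ≤ 1) (hW : W = ν + √(v * ((1 - p) / p)))
    (hcW : c ≤ W) (hqW : 0 < c → q ≤ p * (1 - (c / W) ^ α)) : False := by
  have H' : ∀ p', ε < p' → p' ≤ 1 →
      √((1 - p') / p') * √v ≤ ((1 - ε / p')⁻¹) ^ (1 / α) * c - ν := by
    intro p' hp' hp1'
    have hp0 : 0 < p' := hε.trans hp'
    have h1 : 0 < 1 - ε / p' := by rw [sub_pos, div_lt_one hp0]; exact hp'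
    have h2 : ε ≤ ε / p' := by rw [le_div_iff₀ hp0]; nlinarith
    have h := H (((1 - ε / p')⁻¹) ^ (1 / α)) (by
      have : 0 < 1 - ε := by linarith
      rw [one_div (1 - ε)]
      gcongr)
    rw [← Real.rpow_mul (by positivity)] at h
    have e : 1 / α * -α = -1 := by field_simp
    rw [e, Real.rpow_neg_one, inv_inv] at h
    convert h using 3
    field_simp
    ring
  have hεp : ε < p := hεq.trans_le hqp
  have hp0 : 0 < p := hε.trans hεp
  have hs : √(v * ((1 - p) / p)) = √((1 - p) / p) * √v := by
    rw [Real.sqrt_mul hv.le, mul_comm]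
  have hWτ := H' p hεp hp1
  rcases hc.eq_or_lt with rfl | hc0
  · have h := H' ((ε + p) / 2) (by linarith) (by linarith)
    have hlt : √((1 - p) / p) < √((1 - (ε + p) / 2) / ((ε + p) / 2)) := by
      apply Real.sqrt_lt_sqrt (div_nonneg (by linarith) hp0.le)
      rw [div_lt_div_iff₀ hp0 (by linarith)]
      nlinarith
    have := mul_lt_mul_of_pos_right hlt (Real.sqrt_pos.2 hv)
    linarith
  · have hW0 : 0 < W := hc0.trans_le hcW
    have hq := hqW hc0
    have hd : 0 < 1 - ε / p := by rw [sub_pos, div_lt_one hp0]; exact hεp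
    set τ := ((1 - ε / p)⁻¹) ^ (1 / α) with hτ
    have hτ0 : 0 < τ := by positivity
    have hWc : W ≤ τ * c := by linarith
    have h1 : τ⁻¹ ≤ c / W := by
      rw [le_div_iff₀ hW0, inv_mul_le_iff₀ hτ0]; exact hWc
    have h2 : τ⁻¹ ^ α = 1 - ε / p := by
      rw [hτ, ← Real.inv_rpow (by positivity), inv_inv, ← Real.rpow_mul hd.le]
      rw [one_div_mul_cancel hα.ne', Real.rpow_one]
    have h3 : 1 - ε / p ≤ (c / W) ^ α := by rw [← h2]; gcongr
    have h4 : p * (1 - (c / W) ^ α) ≤ p * (ε / p) := by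
      apply mul_le_mul_of_nonneg_left _ hp0.le; linarith
    rw [mul_div_cancel₀ _ hp0.ne'] at h4
    linarith

lemma AlphaUnimodal.scale_le {n : ℕ} {α : ℝ} {m : Fin n → ℝ} {P : Measure (Fin n → ℝ)}
    [IsProbabilityMeasure P] (h : AlphaUnimodal α m P) (a : Fin n → ℝ)
    {s : ℝ} (hs : s ∈ Set.Ioo (0 : ℝ) 1) :
    ENNReal.ofReal (s ^ α) • (P.map (fun x => a ⬝ᵥ (x - m))).map (fun x => s * x) ≤
      P.map (fun x => a ⬝ᵥ (x - m)) := by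
  obtain ⟨h0, h1⟩ := hs
  have hm : Measurable (fun x : Fin n → ℝ => x - m) := by fun_prop
  have ha : Measurable (fun x : Fin n → ℝ => a ⬝ᵥ x) := by
    unfold dotProduct; fun_prop
  have hf : Measurable (fun x : Fin n → ℝ => a ⬝ᵥ (x - m)) := ha.comp hm
  have hsm : Measurable (fun x : ℝ => s * x) := by fun_prop
  have : IsProbabilityMeasure (P.map (fun x => x - m)) :=
    Measure.isProbabilityMeasure_map hm.aemeasurable
  refine Measure.le_intro fun B hB _ => ?_
  set B' : Set (Fin n → ℝ) := (fun x => a ⬝ᵥ x) ⁻¹' B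
  have hB' : MeasurableSet B' := ha hB
  have key := h B' hB' (Set.mem_Ioi.2 h0) (Set.mem_Ioi.2 one_pos) h1.le
  simp only [Real.one_rpow, one_mul, div_one, one_smul] at key
  have e1 : (1 / s) • B' = (fun x => a ⬝ᵥ x) ⁻¹' ((fun x => s * x) ⁻¹' B) := by
    ext x
    rw [one_div, Set.mem_inv_smul_set_iff₀ h0.ne']
    simp [B', dotProduct_smul]
  rw [Measure.smul_apply, Measure.map_apply hsm hB, Measure.map_apply hf (hsm hB),
    Measure.map_apply hf hB, smul_eq_mul]
  rw [e1, Measure.map_apply hm (ha (hsm hB)), Measure.map_apply hm hB'] at key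
  rw [← ENNReal.toReal_le_toReal (ENNReal.mul_ne_top ENNReal.ofReal_ne_top (measure_ne_top _ _))
    (measure_ne_top _ _), ENNReal.toReal_mul, ENNReal.toReal_ofReal (by positivity)]
  exact key

/-- The law of `m + u ^ (1 / α) • z` for `u` uniform on `(0, 1]`. -/
noncomputable def rayLaw {n : ℕ} (α : ℝ) (m z : Fin n → ℝ) : Measure (Fin n → ℝ) :=
  (volume.restrict (Set.Ioc (0 : ℝ) 1)).map (fun u => m + u ^ (1 / α) • z)

lemma measurable_ray {n : ℕ} (α : ℝ) (m z : Fin n → ℝ) :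
    Measurable (fun u : ℝ => m + u ^ (1 / α) • z) := by fun_prop

instance {n : ℕ} (α : ℝ) (m z : Fin n → ℝ) : IsProbabilityMeasure (rayLaw α m z) := by
  have : IsProbabilityMeasure ((volume : Measure ℝ).restrict (Set.Ioc (0 : ℝ) 1)) :=
    ⟨by simp⟩
  exact Measure.isProbabilityMeasure_map (measurable_ray α m z).aemeasurable

lemma rayLaw_alphaUnimodal {n : ℕ} {α : ℝ} (hα : 0 < α) (m z : Fin n → ℝ) :
    AlphaUnimodal α m (rayLaw α m z) := by
  intro B hB
  have hm : Measurable (fun x : Fin n → ℝ => x - m) := by fun_prop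
  have hray : Measurable (fun v : ℝ => v ^ (1 / α) • z) := by fun_prop
  have key : ∀ t : ℝ, 0 < t →
      t ^ α * (((rayLaw α m z).map (fun x => x - m)) ((1 / t) • B)).toReal =
        volume.real {v : ℝ | v ∈ Set.Ioc 0 (t ^ α) ∧ v ^ (1 / α) • z ∈ B} := by
    intro t ht
    have hta : 0 < t ^ α := by positivity
    have hB' : MeasurableSet ((1 / t) • B) := hB.const_smul_of_ne_zero (by positivity)
    rw [Measure.map_apply hm hB', rayLaw,
      Measure.map_apply (measurable_ray α m z) (hm hB'),
      Measure.restrict_apply (measurable_ray α m z (hm hB'))]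
    have e : (fun u : ℝ => m + u ^ (1 / α) • z) ⁻¹' ((fun x => x - m) ⁻¹' ((1 / t) • B)) ∩
        Set.Ioc 0 1 = (fun u => t ^ α * u) ⁻¹'
          {v : ℝ | v ∈ Set.Ioc 0 (t ^ α) ∧ v ^ (1 / α) • z ∈ B} := by
      ext u
      simp only [Set.mem_inter_iff, Set.mem_preimage, add_sub_cancel_left, Set.mem_Ioc,
        Set.mem_ofPred_eq]
      rw [one_div t, Set.mem_inv_smul_set_iff₀ ht.ne', and_comm, mul_pos_iff_of_pos_left hta]
      have h1 : t ^ α * u ≤ t ^ α ↔ u ≤ 1 := by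
        rw [mul_le_iff_le_one_right hta]
      rw [h1]
      refine and_congr_right fun hu => ?_
      rw [Real.mul_rpow hta.le hu.1.le, ← Real.rpow_mul ht.le, mul_one_div_cancel hα.ne',
        Real.rpow_one, smul_smul]
    rw [e, Real.volume_preimage_mul_left hta.ne', ENNReal.toReal_mul,
      ENNReal.toReal_ofReal (abs_nonneg _), abs_of_pos (by positivity), measureReal_def]
    field_simp
  intro s hs t ht hst
  have hs' : (0 : ℝ) < s := hs
  have ht' : (0 : ℝ) < t := ht
  simp only
  rw [key s hs', key t ht']
  refine measureReal_mono ?_ ?_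
  · rintro v ⟨⟨h1, h2⟩, h3⟩
    exact ⟨⟨h1, h2.trans (by gcongr)⟩, h3⟩
  · refine ((measure_mono (fun v hv => hv.1)).trans_lt
      (measure_Ioc_lt_top (a := 0) (b := t ^ α))).ne

lemma integral_ray {α : ℝ} (hα : 0 < α) (x y z : ℝ) :
    Integrable (fun u : ℝ => x + y * u ^ (1 / α) + z * (u ^ (1 / α)) ^ 2)
      (volume.restrict (Set.Ioc (0 : ℝ) 1)) ∧
    ∫ u in Set.Ioc (0 : ℝ) 1, (x + y * u ^ (1 / α) + z * (u ^ (1 / α)) ^ 2) =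
      x + y * (α / (α + 1)) + z * (α / (α + 2)) := by
  have h1 : ∀ r : ℝ, 0 < r → IntegrableOn (fun u : ℝ => u ^ r) (Set.Ioc 0 1) ∧
      ∫ u in Set.Ioc (0 : ℝ) 1, u ^ r = 1 / (r + 1) := by
    intro r hr
    constructor
    · rw [← intervalIntegrable_iff_integrableOn_Ioc_of_le zero_le_one]
      exact intervalIntegral.intervalIntegrable_rpow' (by linarith)
    · rw [← intervalIntegral.integral_of_le zero_le_one, integral_rpow (Or.inl (by linarith))]
      simp [Real.zero_rpow (by linarith : r + 1 ≠ 0)]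
  have hsq : Set.EqOn (fun u : ℝ => u ^ (2 / α)) (fun u : ℝ => (u ^ (1 / α)) ^ 2)
      (Set.Ioc 0 1) := by
    intro u hu
    simp only
    rw [← Real.rpow_natCast, ← Real.rpow_mul hu.1.le]
    congr 1; push_cast; ring
  obtain ⟨i1, v1⟩ := h1 (1 / α) (by positivity)
  obtain ⟨i2, v2⟩ := h1 (2 / α) (by positivity)
  rw [setIntegral_congr_fun measurableSet_Ioc hsq] at v2
  have i2' := i2.congr_fun hsq measurableSet_Ioc
  have j1 : IntegrableOn (fun u : ℝ => x + y * u ^ (1 / α)) (Set.Ioc 0 1) :=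
    (integrable_const x).fun_add (i1.const_mul y)
  refine ⟨j1.fun_add (i2'.const_mul z), ?_⟩
  rw [integral_add j1 (i2'.const_mul z), integral_add (integrable_const x) (i1.const_mul y),
    integral_const_mul, integral_const_mul, v1, v2]
  simp only [integral_const, smul_eq_mul, measureReal_restrict_apply_univ, Real.volume_real_Ioc]
  simp
  field_simp
  ring

lemma rayLaw_mean {n : ℕ} {α : ℝ} (hα : 0 < α) (m z : Fin n → ℝ) (i : Fin n) :
    Integrable (fun ξ => ξ i) (rayLaw α m z) ∧
    ∫ ξ, ξ i ∂(rayLaw α m z) = m i + z i * (α / (α + 1)) := by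
  obtain ⟨h1, h2⟩ := integral_ray hα (m i) (z i) 0
  have hm := (measurable_ray α m z).aemeasurable (μ := volume.restrict (Set.Ioc (0 : ℝ) 1))
  have hf : Measurable (fun ξ : Fin n → ℝ => ξ i) := by fun_prop
  have e : (fun u : ℝ => (m + u ^ (1 / α) • z) i) =
      fun u => m i + z i * u ^ (1 / α) + 0 * (u ^ (1 / α)) ^ 2 := by
    ext u; simp only [Pi.add_apply, Pi.smul_apply, smul_eq_mul]; ring
  constructor
  · rw [rayLaw, integrable_map_measure hf.aestronglyMeasurable hm]
    simpa only [Function.comp_def, e] using h1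
  · rw [rayLaw, integral_map hm hf.aestronglyMeasurable, e, h2]; ring

lemma rayLaw_second {n : ℕ} {α : ℝ} (hα : 0 < α) (m z : Fin n → ℝ) (i j : Fin n) :
    Integrable (fun ξ => ξ i * ξ j) (rayLaw α m z) ∧
    ∫ ξ, ξ i * ξ j ∂(rayLaw α m z) =
      m i * m j + (m i * z j + m j * z i) * (α / (α + 1)) + z i * z j * (α / (α + 2)) := by
  obtain ⟨h1, h2⟩ := integral_ray hα (m i * m j) (m i * z j + m j * z i) (z i * z j)
  have hm := (measurable_ray α m z).aemeasurable (μ := volume.restrict (Set.Ioc (0 : ℝ) 1))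
  have hf : Measurable (fun ξ : Fin n → ℝ => ξ i * ξ j) := by fun_prop
  have e : (fun u : ℝ => (m + u ^ (1 / α) • z) i * (m + u ^ (1 / α) • z) j) =
      fun u => m i * m j + (m i * z j + m j * z i) * u ^ (1 / α) +
        z i * z j * (u ^ (1 / α)) ^ 2 := by
    ext u; simp only [Pi.add_apply, Pi.smul_apply, smul_eq_mul]; ring
  constructor
  · rw [rayLaw, integrable_map_measure hf.aestronglyMeasurable hm]
    simpa only [Function.comp_def, e] using h1
  · rw [rayLaw, integral_map hm hf.aestronglyMeasurable, e, h2]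

lemma measurable_dotProduct_left {n : ℕ} (a : Fin n → ℝ) :
    Measurable (fun x : Fin n → ℝ => a ⬝ᵥ x) := by
  unfold dotProduct; fun_prop

lemma rayLaw_tail {n : ℕ} {α : ℝ} (hα : 0 < α) (m z a : Fin n → ℝ) {b : ℝ}
    (hb : a ⬝ᵥ m ≤ b) (hz : b - a ⬝ᵥ m < a ⬝ᵥ z) :
    1 - ((b - a ⬝ᵥ m) / (a ⬝ᵥ z)) ^ α ≤ (rayLaw α m z).real {ξ | b < a ⬝ᵥ ξ} := by
  have hW : 0 < a ⬝ᵥ z := by linarith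
  have hset : MeasurableSet {ξ : Fin n → ℝ | b < a ⬝ᵥ ξ} :=
    measurable_dotProduct_left a measurableSet_Ioi
  set x := (b - a ⬝ᵥ m) / (a ⬝ᵥ z) with hx
  have hx0 : 0 ≤ x := div_nonneg (by linarith) hW.le
  have hx1 : x ≤ 1 := by rw [hx, div_le_one hW]; exact hz.le
  have hxa := Real.rpow_le_one hx0 hx1 hα.le
  have hxa0 := Real.rpow_nonneg hx0 α
  have hsub : Set.Ioc (x ^ α) 1 ⊆
      (fun u : ℝ => m + u ^ (1 / α) • z) ⁻¹' {ξ | b < a ⬝ᵥ ξ} ∩ Set.Ioc 0 1 := by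
    intro u hu
    refine ⟨?_, hxa0.trans_lt hu.1, hu.2⟩
    simp only [Set.mem_preimage, Set.mem_ofPred_eq, dotProduct_add, dotProduct_smul, smul_eq_mul]
    have h := Real.rpow_lt_rpow hxa0 hu.1 (show 0 < 1 / α by positivity)
    rw [← Real.rpow_mul hx0, mul_one_div_cancel hα.ne', Real.rpow_one, hx, div_lt_iff₀ hW] at h
    linarith
  rw [rayLaw, measureReal_def, Measure.map_apply (measurable_ray α m z) hset,
    Measure.restrict_apply (measurable_ray α m z hset), ← measureReal_def]
  calc 1 - x ^ α = volume.real (Set.Ioc (x ^ α) 1) := by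
        rw [Real.volume_real_Ioc_of_le hxa]
    _ ≤ _ := measureReal_mono hsub
        ((measure_mono Set.inter_subset_right).trans_lt measure_Ioc_lt_top).ne

/-- A finite mixture of measures. -/
noncomputable def finMixture {J Ω : Type*} [Fintype J] [MeasurableSpace Ω] (w : J → ℝ)
    (P : J → Measure Ω) : Measure Ω :=
  ∑ j, ENNReal.ofReal (w j) • P j

section Mixture

variable {J Ω : Type*} [Fintype J] [MeasurableSpace Ω] {w : J → ℝ} {P : J → Measure Ω}

lemma finMixture_real [∀ j, IsProbabilityMeasure (P j)] (hw : ∀ j, 0 ≤ w j) (A : Set Ω) :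
    (finMixture w P).real A = ∑ j, w j * (P j).real A := by
  rw [finMixture, measureReal_def, Measure.finsetSum_apply, ENNReal.toReal_sum]
  · simp [ENNReal.toReal_ofReal, hw, measureReal_def]
  · intro j _
    exact ENNReal.mul_ne_top ENNReal.ofReal_ne_top (measure_ne_top _ _)

lemma finMixture_isProbabilityMeasure [∀ j, IsProbabilityMeasure (P j)] (hw : ∀ j, 0 ≤ w j)
    (hw1 : ∑ j, w j = 1) : IsProbabilityMeasure (finMixture w P) := by
  constructor
  rw [finMixture, Measure.finsetSum_apply]
  simp only [Measure.smul_apply, measure_univ, smul_eq_mul, mul_one]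
  rw [← ENNReal.ofReal_sum_of_nonneg fun j _ => hw j, hw1, ENNReal.ofReal_one]

lemma integrable_finMixture {f : Ω → ℝ} (hf : ∀ j, Integrable f (P j)) :
    Integrable f (finMixture w P) :=
  integrable_finsetSum_measure.2 fun j _ => (hf j).smul_measure ENNReal.ofReal_ne_top

lemma integral_finMixture {f : Ω → ℝ} (hw : ∀ j, 0 ≤ w j) (hf : ∀ j, Integrable f (P j)) :
    ∫ x, f x ∂(finMixture w P) = ∑ j, w j * ∫ x, f x ∂(P j) := by
  rw [finMixture, integral_finsetSum_measure
    fun j _ => (hf j).smul_measure ENNReal.ofReal_ne_top]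
  simp [integral_smul_measure, ENNReal.toReal_ofReal, hw]

end Mixture

lemma AlphaUnimodal.finMixture {J : Type*} [Fintype J] {n : ℕ} {α : ℝ} {m : Fin n → ℝ}
    {w : J → ℝ} {P : J → Measure (Fin n → ℝ)} [∀ j, IsProbabilityMeasure (P j)]
    (hw : ∀ j, 0 ≤ w j) (h : ∀ j, AlphaUnimodal α m (P j)) :
    AlphaUnimodal α m (finMixture w P) := by
  intro B hB s hs t ht hst
  have hm : Measurable (fun x : Fin n → ℝ => x - m) := by fun_prop
  have key : ∀ t : ℝ, 0 < t →
      t ^ α * (((_root_.finMixture w P).map (fun x => x - m)) ((1 / t) • B)).toReal =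
        ∑ j, w j * (t ^ α * (((P j).map (fun x => x - m)) ((1 / t) • B)).toReal) := by
    intro t ht
    have hB' : MeasurableSet ((1 / t) • B) := hB.const_smul_of_ne_zero (by positivity)
    simp only [Measure.map_apply hm hB', ← measureReal_def]
    rw [finMixture_real hw, Finset.mul_sum]
    exact Finset.sum_congr rfl fun j _ => by ring
  simp only
  rw [key s hs, key t ht]
  exact Finset.sum_le_sum fun j _ => mul_le_mul_of_nonneg_left (h j B hB hs ht hst) (hw j)

/-- A finitely supported law with prescribed first two moments and an atom of mass `p` in a
prescribed direction. -/
lemma exists_finite_law {n : ℕ} (hn : 1 ≤ n) (ν d : Fin n → ℝ) (M : Matrix (Fin n) (Fin n) ℝ)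
    {p : ℝ} (hp : p ∈ Set.Ioo (0 : ℝ) 1) :
    ∃ (w : Bool × Fin n × Bool → ℝ) (z : Bool × Fin n × Bool → Fin n → ℝ),
      (∀ j, 0 ≤ w j) ∧ ∑ j, w j = 1 ∧ (∑ j, if j.1 then w j else 0) = p ∧
      (∀ k, ∑ j, w j * z j k = ν k) ∧
      (∀ k l, ∑ j, w j * (z j k * z j l) = ν k * ν l + d k * d l + (M * Mᵀ) k l) ∧
      ∀ a : Fin n → ℝ, a ᵥ* M = 0 → ∀ j, j.1 = true →
        a ⬝ᵥ z j = a ⬝ᵥ ν + √((1 - p) / p) * (a ⬝ᵥ d) := by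
  obtain ⟨hp0, hp1⟩ := hp
  have hn0 : (0 : ℝ) < n := by exact_mod_cast hn
  have hq : 0 < 1 - p := by linarith
  set x := √((1 - p) / p) with hx
  have hx2 : x ^ 2 = (1 - p) / p := Real.sq_sqrt (by positivity)
  set y := -(p / (1 - p) * x) with hy
  have hxy : p * x + (1 - p) * y = 0 := by rw [hy]; field_simp; ring
  have hxy2 : p * x ^ 2 + (1 - p) * y ^ 2 = 1 := by
    rw [hy, neg_sq, mul_pow, hx2]; field_simp; ring
  set r := √(n : ℝ) with hr
  have hr2 : r ^ 2 = n := Real.sq_sqrt hn0.le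
  refine ⟨fun j => (if j.1 then p else 1 - p) / (2 * n),
    fun j k => ν k + (if j.1 then x else y) * d k + (if j.2.2 then r else -r) * M k j.2.1,
    ?_, ?_, ?_, ?_, ?_, ?_⟩
  · intro j
    dsimp only
    split_ifs <;> positivity
  · simp only [Fintype.sum_prod_type, Fintype.sum_bool]
    simp
    field_simp
    ring
  · simp only [Fintype.sum_prod_type, Fintype.sum_bool]
    simp
    field_simp
    ring
  · intro k
    simp only [Fintype.sum_prod_type, Fintype.sum_bool, if_true, if_false, Bool.false_eq_true]
    rw [← Finset.sum_add_distrib]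
    rw [Finset.sum_congr rfl (g := fun _ => ν k / n)]
    · simp; field_simp
    · intro i _
      field_simp
      linear_combination 2 * d k * hxy
  · intro k l
    simp only [Fintype.sum_prod_type, Fintype.sum_bool, if_true, if_false, Bool.false_eq_true]
    rw [← Finset.sum_add_distrib]
    rw [Finset.sum_congr rfl (g := fun i => (ν k * ν l + d k * d l) / n + M k i * M l i)]
    · rw [Finset.sum_add_distrib, Matrix.mul_apply]
      simp only [Finset.sum_const, Finset.card_univ, Fintype.card_fin, nsmul_eq_mul,
        Matrix.transpose_apply]
      field_simp
    · intro i _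
      field_simp
      linear_combination 2 * (ν k * d l + ν l * d k) * hxy + 2 * d k * d l * hxy2 +
        2 * M k i * M l i * hr2
  · intro a ha j hj
    have : a ⬝ᵥ (fun k => M k j.2.1) = 0 := congrFun ha j.2.1
    have e : (fun k => ν k + (if j.1 then x else y) * d k +
        (if j.2.2 then r else -r) * M k j.2.1) =
        ν + x • d + (if j.2.2 then r else -r) • (fun k => M k j.2.1) := by
      ext k
      simp only [hj, if_true, Pi.add_apply, Pi.smul_apply, smul_eq_mul]
    change a ⬝ᵥ (fun k => ν k + (if j.1 then x else y) * d k +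
        (if j.2.2 then r else -r) * M k j.2.1) = _
    rw [e, dotProduct_add, dotProduct_add, dotProduct_smul, dotProduct_smul, this]
    simp

lemma exists_covariance_split {n : ℕ} {Λ : Matrix (Fin n) (Fin n) ℝ} (hΛ : Λᵀ = Λ)
    (a : Fin n → ℝ) (hv : 0 < (Λ *ᵥ a) ⬝ᵥ (Λ *ᵥ a)) :
    ∃ (d : Fin n → ℝ) (M : Matrix (Fin n) (Fin n) ℝ),
      (∀ k l, d k * d l + (M * Mᵀ) k l = (Λ * Λ) k l) ∧ a ᵥ* M = 0 ∧
      a ⬝ᵥ d = √((Λ *ᵥ a) ⬝ᵥ (Λ *ᵥ a)) := by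
  set h := Λ *ᵥ a with hh
  set v := h ⬝ᵥ h with hvdef
  set g := Λ *ᵥ h with hg
  have hs : 0 < √v := Real.sqrt_pos.2 hv
  have hs2 : √v * √v = v := Real.mul_self_sqrt hv.le
  have haΛ : a ᵥ* Λ = h := by rw [hh, ← vecMul_transpose, hΛ]
  have hhΛ : h ᵥ* Λ = g := by rw [hg, ← vecMul_transpose, hΛ]
  have hag : a ⬝ᵥ g = v := by rw [hg, dotProduct_mulVec, haΛ]
  refine ⟨(√v)⁻¹ • g, Λ - v⁻¹ • vecMulVec g h, ?_, ?_, ?_⟩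
  · have hM : (Λ - v⁻¹ • vecMulVec g h) * (Λ - v⁻¹ • vecMulVec g h)ᵀ =
        Λ * Λ - v⁻¹ • vecMulVec g g := by
      rw [transpose_sub, transpose_smul, transpose_vecMulVec, hΛ]
      simp only [sub_mul, mul_sub, smul_mul_assoc, mul_smul_comm, mul_vecMulVec, vecMulVec_mul,
        vecMulVec_mulVec, ← hg, hhΛ]
      ext k l
      simp only [← hvdef, Matrix.sub_apply, Matrix.smul_apply, vecMulVec_apply, Pi.smul_apply,
        smul_eq_mul, op_smul_eq_smul]
      field_simp
      ring
    intro k l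
    rw [hM]
    have : (√v)⁻¹ * (√v)⁻¹ = v⁻¹ := by rw [← mul_inv, hs2]
    simp only [Pi.smul_apply, smul_eq_mul, Matrix.sub_apply, Matrix.smul_apply, vecMulVec_apply]
    linear_combination g k * g l * this
  · rw [vecMul_sub, haΛ, vecMul_smul, vecMul_vecMulVec, hag, smul_smul,
      inv_mul_cancel₀ hv.ne', one_smul, sub_self]
  · rw [dotProduct_smul, hag, smul_eq_mul]
    field_simp
    rw [sq, hs2]

lemma quadratic_form_eq {n : ℕ} (x y : ℝ) (S : Matrix (Fin n) (Fin n) ℝ) (μ δ a : Fin n → ℝ) :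
    a ⬝ᵥ ((x • (S - vecMulVec μ μ) - y • vecMulVec δ δ) *ᵥ a) =
      x * (a ⬝ᵥ (S *ᵥ a) - (a ⬝ᵥ μ) ^ 2) - y * (a ⬝ᵥ δ) ^ 2 := by
  simp only [sub_mulVec, smul_mulVec, vecMulVec_mulVec, dotProduct_sub, dotProduct_smul,
    smul_eq_mul, op_smul_eq_smul]
  rw [dotProduct_comm μ a, dotProduct_comm δ a]
  ring

lemma moments_dotProduct {n : ℕ} {P : Measure (Fin n → ℝ)} [IsProbabilityMeasure P]
    {μ : Fin n → ℝ} {S : Matrix (Fin n) (Fin n) ℝ}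
    (i1 : ∀ i, Integrable (fun ξ => ξ i) P) (i2 : ∀ i j, Integrable (fun ξ => ξ i * ξ j) P)
    (h1 : ∀ i, (∫ ξ, ξ i ∂P) = μ i) (h2 : ∀ i j, (∫ ξ, ξ i * ξ j ∂P) = S i j)
    (a m : Fin n → ℝ) :
    Integrable (fun ξ => a ⬝ᵥ (ξ - m)) P ∧ Integrable (fun ξ => (a ⬝ᵥ (ξ - m)) ^ 2) P ∧
    ∫ ξ, a ⬝ᵥ (ξ - m) ∂P = a ⬝ᵥ (μ - m) ∧
    ∫ ξ, (a ⬝ᵥ (ξ - m)) ^ 2 ∂P =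
      a ⬝ᵥ (S *ᵥ a) - (a ⬝ᵥ μ) ^ 2 + (a ⬝ᵥ (μ - m)) ^ 2 := by
  have j1 : Integrable (fun ξ => a ⬝ᵥ ξ) P := by
    unfold dotProduct
    exact integrable_finsetSum _ fun i _ => (i1 i).const_mul _
  have v1 : ∫ ξ, a ⬝ᵥ ξ ∂P = a ⬝ᵥ μ := by
    unfold dotProduct
    rw [integral_finsetSum _ fun i _ => (i1 i).const_mul _]
    exact Finset.sum_congr rfl fun i _ => by rw [integral_const_mul, h1]
  have e2 : (fun ξ : Fin n → ℝ => (a ⬝ᵥ ξ) ^ 2) =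
      fun ξ => ∑ i, ∑ j, a i * a j * (ξ i * ξ j) := by
    ext ξ
    rw [sq, dotProduct, Finset.sum_mul_sum]
    exact Finset.sum_congr rfl fun i _ => Finset.sum_congr rfl fun j _ => by ring
  have j2 : Integrable (fun ξ => (a ⬝ᵥ ξ) ^ 2) P := by
    rw [e2]
    exact integrable_finsetSum _ fun i _ => integrable_finsetSum _ fun j _ =>
      (i2 i j).const_mul _
  have v2 : ∫ ξ, (a ⬝ᵥ ξ) ^ 2 ∂P = a ⬝ᵥ (S *ᵥ a) := by
    rw [e2, integral_finsetSum _ fun i _ => integrable_finsetSum _ fun j _ =>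
      (i2 i j).const_mul _]
    simp only [dotProduct, mulVec, Finset.mul_sum]
    refine Finset.sum_congr rfl fun i _ => ?_
    rw [integral_finsetSum _ fun j _ => (i2 i j).const_mul _]
    exact Finset.sum_congr rfl fun j _ => by rw [integral_const_mul, h2]; ring
  have e3 : (fun ξ : Fin n → ℝ => (a ⬝ᵥ (ξ - m)) ^ 2) =
      fun ξ => (a ⬝ᵥ ξ) ^ 2 + (-2 * (a ⬝ᵥ m)) * (a ⬝ᵥ ξ) + (a ⬝ᵥ m) ^ 2 := by
    ext ξ; rw [dotProduct_sub]; ring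
  have j12 := j2.fun_add (j1.const_mul (-2 * (a ⬝ᵥ m)))
  refine ⟨?_, ?_, ?_, ?_⟩
  · simp only [dotProduct_sub]
    exact j1.sub (integrable_const _)
  · rw [e3]
    exact j12.fun_add (integrable_const _)
  · simp only [dotProduct_sub]
    rw [integral_sub j1 (integrable_const _), v1]
    simp
  · rw [e3, integral_add j12 (integrable_const _), integral_add j2 (j1.const_mul _),
      integral_const_mul, v1, v2, dotProduct_sub]
    simp
    ring

lemma exists_strict_violation {α ε ν σ c τ : ℝ} (hα : 0 < α) (hε0 : 0 < ε) (hε1 : ε < 1)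
    (hσ : 0 ≤ σ) (hc : 0 ≤ c) (hτ : (1 / (1 - ε)) ^ (1 / α) ≤ τ)
    (H : τ * c - ν < √((1 - ε - τ ^ (-α)) / ε) * σ) :
    ∃ p, ε < p ∧ p < 1 ∧ c < ν + √((1 - p) / p) * σ ∧
      ε < p * (1 - (c / (ν + √((1 - p) / p) * σ)) ^ α) := by
  have h1ε : 0 < 1 - ε := by linarith
  set τ₀ := (1 / (1 - ε)) ^ (1 / α) with hτ₀
  have hτ₀1 : 1 ≤ τ₀ := by
    apply Real.one_le_rpow _ (by positivity)
    rw [le_div_iff₀ h1ε]; linarith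
  have hτ₀α : τ₀ ^ (-α) = 1 - ε := by
    rw [hτ₀, ← Real.rpow_mul (by positivity)]
    have e : 1 / α * -α = -1 := by field_simp
    rw [e, Real.rpow_neg_one, one_div, inv_inv]
  obtain ⟨t, ht, htH⟩ : ∃ t, τ₀ < t ∧ t * c - ν < √((1 - ε - t ^ (-α)) / ε) * σ := by
    rcases hτ.lt_or_eq with h | h
    · exact ⟨τ, h, H⟩
    · rw [← h, hτ₀α] at H
      simp only [sub_self, zero_div, Real.sqrt_zero, zero_mul] at H
      have hc1 : 0 < c + 1 := by linarith
      refine ⟨τ₀ + (ν - τ₀ * c) / (c + 1), ?_, ?_⟩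
      · have : 0 < (ν - τ₀ * c) / (c + 1) := div_pos (by linarith) hc1
        linarith
      · refine lt_of_lt_of_le ?_ (mul_nonneg (Real.sqrt_nonneg _) hσ)
        have : (ν - τ₀ * c) / (c + 1) * c < ν - τ₀ * c := by
          rw [div_mul_eq_mul_div, div_lt_iff₀ hc1]; nlinarith
        linarith
  have ht0 : 0 < t := by linarith
  have htα : t ^ (-α) < 1 - ε := by
    rw [← hτ₀α]
    exact Real.rpow_lt_rpow_of_neg (by linarith) ht (by linarith)
  have htα0 : 0 < t ^ (-α) := by positivity
  have hd : 0 < 1 - t ^ (-α) := by linarith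
  refine ⟨ε / (1 - t ^ (-α)), ?_, ?_, ?_⟩
  · rw [lt_div_iff₀ hd]; nlinarith
  · rw [div_lt_one hd]; linarith
  have e : (1 - ε / (1 - t ^ (-α))) / (ε / (1 - t ^ (-α))) = (1 - ε - t ^ (-α)) / ε := by
    field_simp
    ring
  rw [e]
  set W := ν + √((1 - ε - t ^ (-α)) / ε) * σ with hW
  have hWt : t * c < W := by linarith
  have hcW : c < W := by nlinarith
  have hW0 : 0 < W := hc.trans_lt hcW
  refine ⟨hcW, ?_⟩
  have h2 : (c / W) ^ α < t ^ (-α) := by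
    rw [Real.rpow_neg ht0.le, ← Real.inv_rpow ht0.le]
    apply Real.rpow_lt_rpow (by positivity) _ hα
    rw [div_lt_iff₀ hW0, lt_inv_mul_iff₀ ht0]
    exact hWt
  have hp0 : 0 < ε / (1 - t ^ (-α)) := by positivity
  calc ε = ε / (1 - t ^ (-α)) * (1 - t ^ (-α)) := by field_simp
    _ < _ := mul_lt_mul_of_pos_left (by linarith) hp0

theorem stmt1 (n : ℕ) (hn : 1 ≤ n) (α : ℝ) (hα : 1 ≤ α) (ε : ℝ)
    (hε : ε ∈ Set.Ioo (0 : ℝ) (1 / 2)) (μ : Fin n → ℝ) (S : Matrix (Fin n) (Fin n) ℝ)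
    (hS : S.IsSymm) (mt : Fin n → ℝ) (a : Fin n → ℝ) (b : ℝ)
    (hpd : (((α + 2) / α) • (S - vecMulVec μ μ)
        - (1 / α ^ 2) • vecMulVec (μ - mt) (μ - mt)).PosDef)
    (hmode : a ⬝ᵥ mt ≤ b)
    (Λ : Matrix (Fin n) (Fin n) ℝ) (hΛ : Λ.PosSemidef)
    (hΛsq : Λ * Λ = ((α + 2) / α) • (S - vecMulVec μ μ)
        - (1 / α ^ 2) • vecMulVec (μ - mt) (μ - mt)) :
    (∀ P : Measure (Fin n → ℝ), IsProbabilityMeasure P →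
      AlphaUnimodal α mt P →
      (∀ i, Integrable (fun ξ => ξ i) P) →
      (∀ i j, Integrable (fun ξ => ξ i * ξ j) P) →
      (∀ i, (∫ ξ, ξ i ∂P) = μ i) →
      (∀ i j, (∫ ξ, ξ i * ξ j ∂P) = S i j) →
      ENNReal.ofReal (1 - ε) ≤ P {ξ | a ⬝ᵥ ξ ≤ b}) ↔
    (∀ τ : ℝ, (1 / (1 - ε)) ^ (1 / α) ≤ τ →
      Real.sqrt ((1 - ε - τ ^ (-α)) / ε) * Real.sqrt ((Λ *ᵥ a) ⬝ᵥ (Λ *ᵥ a)) ≤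
        τ * (b - μ ⬝ᵥ a) + (τ - (α + 1) / α) * ((μ - mt) ⬝ᵥ a)) := by
  obtain ⟨hε0, hε2⟩ := hε
  have hα0 : 0 < α := by linarith
  have hΛT : Λᵀ = Λ := by
    have := hΛ.isHermitian
    rwa [IsHermitian, conjTranspose_eq_transpose_of_trivial] at this
  set v := (Λ *ᵥ a) ⬝ᵥ (Λ *ᵥ a) with hv
  have hvC : v = a ⬝ᵥ ((Λ * Λ) *ᵥ a) := by
    rw [hv, ← mulVec_mulVec, dotProduct_mulVec a, ← mulVec_transpose, hΛT]
  have hvq : v = (α + 2) / α * (a ⬝ᵥ (S *ᵥ a) - (a ⬝ᵥ μ) ^ 2) -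
      1 / α ^ 2 * (a ⬝ᵥ (μ - mt)) ^ 2 := by
    rw [hvC, hΛsq, quadratic_form_eq]
  have hvpos : a ≠ 0 → 0 < v := by
    intro ha
    rw [hvC, hΛsq]
    simpa using hpd.dotProduct_mulVec_pos ha
  set c := b - a ⬝ᵥ mt with hc
  have hc0 : 0 ≤ c := by linarith
  have hrhs : ∀ τ : ℝ, τ * (b - μ ⬝ᵥ a) + (τ - (α + 1) / α) * ((μ - mt) ⬝ᵥ a) =
      τ * c - a ⬝ᵥ (μ - mt) * ((α + 1) / α) := by
    intro τ
    rw [dotProduct_comm _ a, dotProduct_comm _ a, hc, dotProduct_sub]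
    ring
  simp only [hrhs]
  have hmeas := measurable_dotProduct_left a
  have hcompl : {ξ : Fin n → ℝ | a ⬝ᵥ ξ ≤ b}ᶜ = {ξ | b < a ⬝ᵥ ξ} := by
    ext ξ; simp
  have hset : MeasurableSet {ξ : Fin n → ℝ | a ⬝ᵥ ξ ≤ b} := hmeas measurableSet_Iic
  have hreal : ∀ P : Measure (Fin n → ℝ), IsProbabilityMeasure P →
      (ENNReal.ofReal (1 - ε) ≤ P {ξ | a ⬝ᵥ ξ ≤ b} ↔ P.real {ξ | b < a ⬝ᵥ ξ} ≤ ε) := by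
    intro P hP
    rw [ENNReal.ofReal_le_iff_le_toReal (measure_ne_top _ _), ← measureReal_def, ← hcompl,
      probReal_compl_eq_one_sub hset]
    constructor <;> intro h <;> linarith
  constructor
  · intro H τ hτ
    by_contra! hviol
    have ha : a ≠ 0 := by
      rintro rfl
      have : 0 ≤ τ := (Real.rpow_nonneg (one_div_nonneg.2 (by linarith)) _).trans hτ
      simp only [hv, mulVec_zero, zero_dotProduct, Real.sqrt_zero, mul_zero, zero_mul,
        sub_zero] at hviol
      nlinarith
    obtain ⟨p, hεp, hp1, hcW, hpW⟩ := exists_strict_violation hα0 hε0 (by linarith)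
      (Real.sqrt_nonneg v) hc0 hτ hviol
    obtain ⟨d, M, hdM, haM, had⟩ := exists_covariance_split hΛT a (hvpos ha)
    obtain ⟨w, z, hw, hw1, hwp, hz1, hz2, hza⟩ :=
      exists_finite_law hn (((α + 1) / α) • (μ - mt)) d M ⟨hε0.trans hεp, hp1⟩
    set P := finMixture w (fun j => rayLaw α mt (z j)) with hP
    have hPprob : IsProbabilityMeasure P := finMixture_isProbabilityMeasure hw hw1
    have hle := H P hPprob
      (AlphaUnimodal.finMixture hw fun j => rayLaw_alphaUnimodal hα0 mt (z j))
      (fun i => integrable_finMixture fun j => (rayLaw_mean hα0 mt (z j) i).1)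
      (fun i k => integrable_finMixture fun j => (rayLaw_second hα0 mt (z j) i k).1)
      (fun i => by
        rw [integral_finMixture hw fun j => (rayLaw_mean hα0 mt (z j) i).1]
        have : ∀ j, w j * ∫ ξ, ξ i ∂(rayLaw α mt (z j)) =
            w j * mt i + w j * z j i * (α / (α + 1)) := fun j => by
          rw [(rayLaw_mean hα0 mt (z j) i).2]; ring
        simp only [this, Finset.sum_add_distrib, ← Finset.sum_mul, hw1, hz1]
        simp
        field_simp
        ring)
      (fun i k => by
        rw [integral_finMixture hw fun j => (rayLaw_second hα0 mt (z j) i k).1]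
        have : ∀ j, w j * ∫ ξ, ξ i * ξ k ∂(rayLaw α mt (z j)) =
            w j * (mt i * mt k) + (w j * z j k * (mt i * (α / (α + 1))) +
              w j * z j i * (mt k * (α / (α + 1)))) +
            w j * (z j i * z j k) * (α / (α + 2)) := fun j => by
          rw [(rayLaw_second hα0 mt (z j) i k).2]; ring
        simp only [this, Finset.sum_add_distrib, ← Finset.sum_mul, hw1, hz1, hz2]
        rw [add_assoc (_ * _) (d i * d k), hdM, hΛsq]
        simp only [Pi.smul_apply, Pi.sub_apply, Matrix.sub_apply, Matrix.smul_apply,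
          vecMulVec_apply, smul_eq_mul]
        field_simp
        ring)
    rw [hreal P hPprob, hP, finMixture_real hw] at hle
    refine absurd hle (not_le.2 (hpW.trans_le ?_))
    rw [← hwp, Finset.sum_mul]
    refine Finset.sum_le_sum fun j _ => ?_
    rcases hj : j.1 with _ | _
    · simpa using mul_nonneg (hw j) measureReal_nonneg
    · have hzj := hza a haM j hj
      rw [had, dotProduct_smul, smul_eq_mul, mul_comm ((α + 1) / α)] at hzj
      rw [if_pos rfl]
      refine mul_le_mul_of_nonneg_left ?_ (hw j)
      rw [hwp, ← hzj]
      exact rayLaw_tail hα0 mt (z j) a hmode (by rw [hzj]; exact hcW)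
  · intro H P hP hU i1 i2 h1 h2
    rw [hreal P hP]
    by_contra! hlt
    have ha : a ≠ 0 := by
      rintro rfl
      simp only [zero_dotProduct] at hlt hmode
      simp [hmode.not_gt] at hlt
      linarith
    have hf : Measurable (fun x : Fin n → ℝ => a ⬝ᵥ (x - mt)) :=
      hmeas.comp (measurable_id.sub_const mt)
    have hρ : IsProbabilityMeasure (P.map fun x => a ⬝ᵥ (x - mt)) :=
      Measure.isProbabilityMeasure_map hf.aemeasurable
    obtain ⟨j1, j2, v1, v2⟩ := moments_dotProduct i1 i2 h1 h2 a mt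
    have hq : (P.map fun x => a ⬝ᵥ (x - mt)).real (Set.Ioi c) = P.real {ξ | b < a ⬝ᵥ ξ} := by
      rw [map_measureReal_apply hf measurableSet_Ioi]
      congr 1
      ext ξ
      simp [hc, dotProduct_sub]
    have hsq : Measurable (fun z : ℝ => z ^ 2) := by fun_prop
    obtain ⟨p, W, hqp, hp1, hW, hcW, hqW⟩ := exists_tail_bound_of_forall_scale
      (ρ := P.map fun x => a ⬝ᵥ (x - mt))
      ((integrable_map_measure measurable_id.aestronglyMeasurable hf.aemeasurable).2 j1)
      ((integrable_map_measure hsq.aestronglyMeasurable hf.aemeasurable).2 j2)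
      hα0 hc0 (fun s hs => hU.scale_le a hs) (by rw [hq]; linarith)
    rw [hq] at hqp hqW
    rw [integral_map (f := fun z => z) hf.aemeasurable measurable_id.aestronglyMeasurable,
      integral_map hf.aemeasurable hsq.aestronglyMeasurable, v1, v2] at hW
    refine no_violation hα0 hε0 (hvpos ha) hc0 H hlt hqp hp1 ?_ hcW hqW
    rw [hW, hvq]
    congr 3
    field_simp
    ring
end

section
/- Let α ≥ 1 and ε ∈ (0, 1/2) be reals, and let R̃ > 0. Then τ₀ < (α+1)/α, the function ĥ satisfies ĥ(τ₀) = R̃, and ĥ is strictly decreasing on [τ₀, ∞). -/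
/-- `τ₀ = (1/(1-ε))^(1/α)`. -/
noncomputable def tau0 (α ε : ℝ) : ℝ := (1 / (1 - ε)) ^ (1 / α)

/-- `g(τ) = √((1-ε-τ^(-α))/ε)`. -/
noncomputable def gfun (α ε τ : ℝ) : ℝ := Real.sqrt ((1 - ε - τ ^ (-α)) / ε)

/-- `f(τ) = -(ατ - α - 1)`. -/
noncomputable def ffun (α τ : ℝ) : ℝ := -(α * τ - α - 1)

/-- `ĥ(τ) = f(τ)·R̃/√(g(τ)² + f(τ)²)`. -/
noncomputable def hhat (α ε R τ : ℝ) : ℝ :=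
  ffun α τ * R / Real.sqrt ((gfun α ε τ) ^ 2 + (ffun α τ) ^ 2)

/-- A negative real power is convex on the positive reals. -/
theorem rpow_neg_convex_comb_le {p x z a b : ℝ} (hp : 0 ≤ p) (hx : 0 < x) (hz : 0 < z)
    (ha : 0 ≤ a) (hb : 0 ≤ b) (hab : a + b = 1) :
    (a * x + b * z) ^ (-p) ≤ a * x ^ (-p) + b * z ^ (-p) := by
  have hmean := Real.geom_mean_le_arith_mean2_weighted ha hb hx.le hz.le hab
  have hmean' := Real.geom_mean_le_arith_mean2_weighted ha hb
    (Real.rpow_nonneg hx.le (-p)) (Real.rpow_nonneg hz.le (-p)) hab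
  have hpos : 0 < x ^ a * z ^ b := by positivity
  calc (a * x + b * z) ^ (-p) ≤ (x ^ a * z ^ b) ^ (-p) :=
        Real.rpow_le_rpow_of_nonpos hpos hmean (neg_nonpos.2 hp)
    _ = (x ^ (-p)) ^ a * (z ^ (-p)) ^ b := by
        rw [Real.mul_rpow (by positivity) (by positivity), ← Real.rpow_mul hx.le,
          ← Real.rpow_mul hz.le, ← Real.rpow_mul hx.le, ← Real.rpow_mul hz.le,
          mul_comm a, mul_comm b]
    _ ≤ _ := hmean'

theorem div_sqrt_lt_div_sqrt {x y A B : ℝ} (hy : 0 ≤ y) (hA : 0 < A) (hB : 0 < B)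
    (h : x ^ 2 * B < y ^ 2 * A) : x / √A < y / √B := by
  rw [div_lt_div_iff₀ (Real.sqrt_pos.2 hA) (Real.sqrt_pos.2 hB)]
  apply lt_of_pow_lt_pow_left₀ 2 (by positivity)
  rwa [mul_pow, mul_pow, Real.sq_sqrt hA.le, Real.sq_sqrt hB.le]

theorem tau0_pos {α ε : ℝ} (hε : ε < 1) : 0 < tau0 α ε :=
  Real.rpow_pos_of_pos (one_div_pos.2 (by linarith)) _

theorem tau0_rpow_neg {α ε : ℝ} (hα : α ≠ 0) (hε : ε < 1) : tau0 α ε ^ (-α) = 1 - ε := by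
  have h : 0 < 1 - ε := by linarith
  rw [tau0, ← Real.rpow_mul (by positivity), mul_neg, one_div_mul_cancel hα, Real.rpow_neg_one,
    one_div, inv_inv]

theorem two_le_rpow {α : ℝ} (hα : 1 ≤ α) : 2 ≤ ((α + 1) / α) ^ α := by
  have h0 : 0 < α := by linarith
  have h := one_add_mul_self_le_rpow_one_add (s := 1 / α)
    (by have : 0 < 1 / α := by positivity
        linarith) hα
  rw [mul_one_div_cancel h0.ne', show 1 + 1 / α = (α + 1) / α by field_simp] at h
  linarith

theorem tau0_lt {α ε : ℝ} (hα : 1 ≤ α) (hε : ε < 1 / 2) : tau0 α ε < (α + 1) / α := by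
  have h0 : 0 < α := by linarith
  have h1 : 0 < 1 - ε := by linarith
  rw [tau0, one_div α, Real.rpow_inv_lt_iff_of_pos (by positivity) (by positivity) h0]
  refine lt_of_lt_of_le ?_ (two_le_rpow hα)
  rw [div_lt_iff₀ h1]
  linarith

theorem gfun_sq {α ε τ : ℝ} (hα : 0 < α) (hε : 0 < ε) (hε1 : ε < 1) (hτ : tau0 α ε ≤ τ) :
    gfun α ε τ ^ 2 = (1 - ε - τ ^ (-α)) / ε := by
  refine Real.sq_sqrt (div_nonneg ?_ hε.le)
  rw [← tau0_rpow_neg hα.ne' hε1, sub_nonneg]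
  exact Real.rpow_le_rpow_of_nonpos (tau0_pos hε1) hτ (by linarith)

/-- Past the zero of `f`, the ratio `g² / f²` strictly decreases. -/
theorem ffun_sq_mul_lt {α ε x y : ℝ} (hα : 1 ≤ α) (hε : ε < 1 / 2)
    (hx : (α + 1) / α < x) (hxy : x < y) :
    ffun α x ^ 2 * (1 - ε - y ^ (-α)) < ffun α y ^ 2 * (1 - ε - x ^ (-α)) := by
  have h0 : 0 < α := by linarith
  have hs : 0 < (α + 1) / α := by positivity
  set s := (α + 1) / α with hs_def
  have hsα : α * s = α + 1 := by rw [hs_def]; field_simp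
  have hf (t : ℝ) : ffun α t = -(α * (t - s)) := by
    rw [ffun, mul_sub, hsα]; ring
  have hd : 0 < y - s := by linarith
  have hG : s ^ (-α) ≤ 1 / 2 := by
    rw [Real.rpow_neg hs.le, ← one_div]
    exact one_div_le_one_div_of_le two_pos (two_le_rpow hα)
  have hGy : y ^ (-α) ≤ s ^ (-α) :=
    Real.rpow_le_rpow_of_nonpos hs (by linarith) (by linarith)
  have hconv := rpow_neg_convex_comb_le (p := α) (a := (y - x) / (y - s))
    (b := (x - s) / (y - s)) h0.le hs (by linarith : 0 < y)
    (div_nonneg (by linarith) hd.le) (div_nonneg (by linarith) hd.le) (by field_simp; ring)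
  rw [show (y - x) / (y - s) * s + (x - s) / (y - s) * y = x by field_simp; ring,
    div_mul_eq_mul_div, div_mul_eq_mul_div, ← add_div, le_div_iff₀ hd] at hconv
  have hlin : (x - s) * (1 - ε - y ^ (-α)) < (y - s) * (1 - ε - x ^ (-α)) := by
    nlinarith [mul_pos (sub_pos.2 hxy) (by linarith : 0 < 1 - ε - s ^ (-α))]
  have hsq : (x - s) ^ 2 * (1 - ε - y ^ (-α)) < (y - s) ^ 2 * (1 - ε - x ^ (-α)) := by
    have h1 := mul_lt_mul_of_pos_left hlin hd
    have h2 : 0 ≤ (y - x) * ((x - s) * (1 - ε - y ^ (-α))) :=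
      mul_nonneg (by linarith) (mul_nonneg (by linarith) (by linarith))
    nlinarith
  rw [hf, hf]
  have := mul_lt_mul_of_pos_left hsq (pow_pos h0 2)
  nlinarith

theorem stmt4 (α ε R : ℝ) (hα : 1 ≤ α) (hε : ε ∈ Set.Ioo (0 : ℝ) (1 / 2)) (hR : 0 < R) :
    tau0 α ε < (α + 1) / α ∧ hhat α ε R (tau0 α ε) = R ∧
    StrictAntiOn (hhat α ε R) (Set.Ici (tau0 α ε)) := by
  obtain ⟨hε0, hε2⟩ := hε
  have h0 : 0 < α := by linarith
  have hε1 : ε < 1 := by linarith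
  have hlt := tau0_lt hα hε2
  have hf0 : 0 < ffun α (tau0 α ε) := by
    rw [lt_div_iff₀ h0] at hlt
    rw [ffun]
    linarith
  refine ⟨hlt, ?_, ?_⟩
  · rw [hhat, gfun_sq h0 hε0 hε1 le_rfl, tau0_rpow_neg h0.ne' hε1, sub_self, zero_div, zero_add,
      Real.sqrt_sq hf0.le, mul_div_cancel_left₀ _ hf0.ne']
  intro x hx y hy hxy
  rw [Set.mem_Ici] at hx hy
  have hx0 : 0 < x := (tau0_pos hε1).trans_le hx
  have hGx : 0 ≤ gfun α ε x ^ 2 := sq_nonneg _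
  have hGxy : gfun α ε x ^ 2 < gfun α ε y ^ 2 := by
    rw [gfun_sq h0 hε0 hε1 hx, gfun_sq h0 hε0 hε1 hy]
    have := Real.rpow_lt_rpow_of_neg hx0 hxy (neg_lt_zero.2 h0)
    gcongr
  have hfxy : ffun α y < ffun α x := by
    rw [ffun, ffun]
    nlinarith
  have hA : 0 < gfun α ε y ^ 2 + ffun α y ^ 2 := by nlinarith [sq_nonneg (ffun α y)]
  have hB : 0 < gfun α ε x ^ 2 + ffun α x ^ 2 := by
    rcases hx.eq_or_lt with rfl | h
    · positivity
    · have hpow := Real.rpow_lt_rpow_of_neg (tau0_pos hε1) h (neg_lt_zero.2 h0)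
      rw [tau0_rpow_neg h0.ne' hε1] at hpow
      have : 0 < (1 - ε - x ^ (-α)) / ε := div_pos (by linarith) hε0
      rw [gfun_sq h0 hε0 hε1 hx]
      positivity
  rw [hhat, hhat, mul_div_right_comm, mul_div_right_comm]
  refine mul_lt_mul_of_pos_right ?_ hR
  rcases le_or_gt 0 (ffun α y) with hy0 | hy0
  · apply div_sqrt_lt_div_sqrt (hy0.trans hfxy.le) hA hB
    have h1 : ffun α y ^ 2 < ffun α x ^ 2 := by gcongr
    nlinarith [mul_le_mul_of_nonneg_right h1.le hGx,
      mul_lt_mul_of_pos_left hGxy ((sq_nonneg _).trans_lt h1)]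
  rcases le_or_gt 0 (ffun α x) with hfx | hfx
  · exact (div_neg_of_neg_of_pos hy0 (Real.sqrt_pos.2 hA)).trans_le
      (div_nonneg hfx (Real.sqrt_nonneg _))
  · have hxs : (α + 1) / α < x := by
      rw [div_lt_iff₀ h0]
      rw [ffun] at hfx
      linarith
    have key := ffun_sq_mul_lt hα hε2 hxs hxy
    have key' : ffun α x ^ 2 * gfun α ε y ^ 2 < ffun α y ^ 2 * gfun α ε x ^ 2 := by
      rw [gfun_sq h0 hε0 hε1 hx, gfun_sq h0 hε0 hε1 hy, ← mul_div_assoc, ← mul_div_assoc]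
      gcongr
    have := div_sqrt_lt_div_sqrt (x := -ffun α x) (y := -ffun α y) (by linarith) hB hA
      (by nlinarith)
    rw [neg_div, neg_div] at this
    linarith
end

section
/- (Lemma 1) Let α ≥ 1, ε ∈ (0, 1/2), R̃ > 0, and let h̲ ∈ (−R̃, R̃). Let τ̄ be the unique τ ≥ τ₀ with ĥ(τ̄) = h̲. If h̲ ≥ 0, then τ̄ ∈ [τ₀, (α+1)/α]. If h̲ < 0, then τ̄ ∈ [(α+1)/α, τ₁], where τ₁ = −(h̲·√((1−ε)/(ε(R̃² − h̲²))) − (α+1))/α. -/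
theorem gfun_sq_le {α ε τ : ℝ} (hε : 0 < ε) (hε1 : ε ≤ 1) (hτ : 0 ≤ τ) :
    gfun α ε τ ^ 2 ≤ (1 - ε) / ε := by
  have hpow : 0 ≤ τ ^ (-α) := Real.rpow_nonneg hτ _
  have hle : (1 - ε - τ ^ (-α)) / ε ≤ (1 - ε) / ε :=
    div_le_div_of_nonneg_right (by linarith) hε.le
  have hnn : 0 ≤ (1 - ε) / ε := div_nonneg (by linarith) hε.le
  calc gfun α ε τ ^ 2 ≤ Real.sqrt ((1 - ε) / ε) ^ 2 := by
        unfold gfun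
        gcongr
    _ = (1 - ε) / ε := Real.sq_sqrt hnn

theorem ffun_nonneg_of_hhat_nonneg {α ε R τ : ℝ} (hR : 0 < R) (h : 0 ≤ hhat α ε R τ) :
    0 ≤ ffun α τ := by
  by_contra! hf
  have hS : 0 < Real.sqrt (gfun α ε τ ^ 2 + ffun α τ ^ 2) :=
    Real.sqrt_pos.2 (add_pos_of_nonneg_of_pos (sq_nonneg _) (sq_pos_of_neg hf))
  exact absurd h (not_le.2 (div_neg_of_neg_of_pos (mul_neg_of_neg_of_pos hf hR) hS))

theorem ffun_neg_of_hhat_neg {α ε R τ : ℝ} (hR : 0 < R) (h : hhat α ε R τ < 0) :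
    ffun α τ < 0 := by
  by_contra! hf
  exact absurd h (not_lt.2 (div_nonneg (mul_nonneg hf hR.le) (Real.sqrt_nonneg _)))

theorem ffun_sq_mul_eq {α ε R τ : ℝ} (hf : ffun α τ ≠ 0) :
    ffun α τ ^ 2 * (R ^ 2 - hhat α ε R τ ^ 2) = hhat α ε R τ ^ 2 * gfun α ε τ ^ 2 := by
  have hS : 0 < gfun α ε τ ^ 2 + ffun α τ ^ 2 := by positivity
  have hsq : hhat α ε R τ ^ 2 * (gfun α ε τ ^ 2 + ffun α τ ^ 2) = (ffun α τ * R) ^ 2 := by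
    rw [hhat, div_pow, Real.sq_sqrt hS.le, div_mul_cancel₀ _ hS.ne']
  linear_combination -hsq

theorem stmt6 (α ε R hlo τbar : ℝ) (hα : 1 ≤ α) (hε : ε ∈ Set.Ioo (0 : ℝ) (1 / 2)) (hR : 0 < R)
    (hh : hlo ∈ Set.Ioo (-R) R) (hτ : tau0 α ε ≤ τbar) (heq : hhat α ε R τbar = hlo) :
    (0 ≤ hlo → τbar ∈ Set.Icc (tau0 α ε) ((α + 1) / α)) ∧
    (hlo < 0 → τbar ∈ Set.Icc ((α + 1) / α)
      (-(hlo * Real.sqrt ((1 - ε) / (ε * (R ^ 2 - hlo ^ 2))) - (α + 1)) / α)) := by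
  obtain ⟨hε0, hε1⟩ := hε
  have hα0 : 0 < α := by linarith
  have hτ0 : 0 < τbar := (tau0_pos (by linarith)).trans_le hτ
  subst heq
  refine ⟨fun h => ⟨hτ, ?_⟩, fun h => ?_⟩
  · have hf := ffun_nonneg_of_hhat_nonneg hR h
    rw [ffun] at hf
    rw [le_div_iff₀ hα0]
    linarith
  · have hf := ffun_neg_of_hhat_neg hR h
    have hmul := ffun_sq_mul_eq (ε := ε) (R := R) hf.ne
    have hg := gfun_sq_le (α := α) hε0 (by linarith) hτ0.le
    set k := hhat α ε R τbar
    have hd : 0 < R ^ 2 - k ^ 2 := by nlinarith [hh.1, hh.2]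
    have hq : 0 ≤ (1 - ε) / (ε * (R ^ 2 - k ^ 2)) :=
      div_nonneg (by linarith) (by positivity)
    have hsq : ffun α τbar ^ 2 ≤ (k * Real.sqrt ((1 - ε) / (ε * (R ^ 2 - k ^ 2)))) ^ 2 := by
      rw [mul_pow, Real.sq_sqrt hq, ← div_div, ← mul_div_assoc, le_div_iff₀ hd, hmul]
      gcongr
    have hle := sq_le_sq.1 hsq
    rw [abs_of_neg hf, abs_of_nonpos (mul_nonpos_of_nonpos_of_nonneg h.le (Real.sqrt_nonneg _))]
      at hle
    rw [ffun] at hf hle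
    constructor
    · rw [div_le_iff₀ hα0]
      linarith
    · rw [le_div_iff₀ hα0]
      linarith
end

section
/- (Lemma 2) Let α ≥ 1, ε ∈ (0, 1/2), R̃ > 0, c̃ ∈ ℝ, and h̲ ∈ (−R̃, R̃) with c̃ + αh̲ > 0. Set C₃ = √(R̃² − h̲²), C₂ = α²C₃²/(4ε(c̃ + αh̲)²), and τ₂ = [(−1 + √(1 + 4(1−ε)C₂))/(2C₂)]^{−1/α}. Then τ₂ > τ₀ and C₃·g′(τ₂) ≤ c̃ + αh̲, where g′(τ) = (α/ε)·τ^{−α−1}/(2g(τ)) is the derivative of g on (τ₀, ∞); equivalently, the derivative of F₃(τ) = C₃·g(τ) − (c̃ + αh̲)·τ + (α+1)·h̲ at τ₂ is nonpositive. -/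
theorem tau0_eq_rpow_neg {α ε : ℝ} (hε : ε < 1) : tau0 α ε = (1 - ε) ^ (-1 / α) := by
  have h : 0 ≤ 1 - ε := by linarith
  rw [tau0, one_div (1 - ε), Real.inv_rpow h, ← Real.rpow_neg h, neg_div]

theorem rpow_neg_one_div_rpow_neg {α x : ℝ} (hα : α ≠ 0) (hx : 0 ≤ x) :
    (x ^ (-1 / α)) ^ (-α) = x := by
  rw [← Real.rpow_mul hx, show -1 / α * -α = 1 by field_simp, Real.rpow_one]

theorem rpow_neg_lt_of_tau0_lt {α ε τ : ℝ} (hα : 0 < α) (hε : ε < 1) (hτ : tau0 α ε < τ) :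
    τ ^ (-α) < 1 - ε := by
  rw [tau0_eq_rpow_neg hε] at hτ
  have h : 0 < 1 - ε := by linarith
  have := Real.rpow_lt_rpow_of_neg (Real.rpow_pos_of_pos h _) hτ (neg_lt_zero.mpr hα)
  rwa [rpow_neg_one_div_rpow_neg hα.ne' h.le] at this

theorem hasDerivAt_gfun {α ε τ : ℝ} (hα : 0 < α) (hε₀ : 0 < ε) (hε : ε < 1)
    (hτ : tau0 α ε < τ) :
    HasDerivAt (gfun α ε) ((α / ε) * τ ^ (-α - 1) / (2 * gfun α ε τ)) τ := by
  have hτ_pos : 0 < τ := by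
    refine lt_trans ?_ hτ
    rw [tau0_eq_rpow_neg hε]
    exact Real.rpow_pos_of_pos (by linarith) _
  have hlt := rpow_neg_lt_of_tau0_lt hα hε hτ
  have hne : (1 - ε - τ ^ (-α)) / ε ≠ 0 := (div_pos (by linarith) hε₀).ne'
  have h := (((Real.hasDerivAt_rpow_const (p := -α) (Or.inl hτ_pos.ne')).const_sub
    (1 - ε)).div_const ε).sqrt hne
  refine h.congr_deriv ?_
  rw [gfun]
  congr 1
  ring

/-- The positive root of `a x² + x = b`. -/
theorem quadratic_root_spec {a b x : ℝ} (ha : 0 < a) (hb : 0 < b)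
    (hx : x = (-1 + Real.sqrt (1 + 4 * b * a)) / (2 * a)) :
    0 < x ∧ a * x ^ 2 + x = b := by
  have hba : 0 < b * a := mul_pos hb ha
  have hs : 1 < Real.sqrt (1 + 4 * b * a) := by
    rw [Real.lt_sqrt zero_le_one]
    linarith
  have hsq : Real.sqrt (1 + 4 * b * a) ^ 2 = 1 + 4 * b * a := Real.sq_sqrt (by linarith)
  refine ⟨hx ▸ div_pos (by linarith) (by linarith), ?_⟩
  rw [hx]
  generalize Real.sqrt (1 + 4 * b * a) = s at hsq
  field_simp
  linear_combination hsq

theorem stmt12 (α ε R c hlo : ℝ) (hα : 1 ≤ α) (hε : ε ∈ Set.Ioo (0 : ℝ) (1 / 2)) (hR : 0 < R)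
    (hh : hlo ∈ Set.Ioo (-R) R) (hpos : 0 < c + α * hlo)
    (C3 C2 τ2 : ℝ) (hC3 : C3 = Real.sqrt (R ^ 2 - hlo ^ 2))
    (hC2 : C2 = α ^ 2 * C3 ^ 2 / (4 * ε * (c + α * hlo) ^ 2))
    (hτ2 : τ2 = ((-1 + Real.sqrt (1 + 4 * (1 - ε) * C2)) / (2 * C2)) ^ (-1 / α)) :
    (∀ τ ∈ Set.Ioi (tau0 α ε),
      HasDerivAt (gfun α ε) ((α / ε) * τ ^ (-α - 1) / (2 * gfun α ε τ)) τ) ∧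
    tau0 α ε < τ2 ∧
    C3 * ((α / ε) * τ2 ^ (-α - 1) / (2 * gfun α ε τ2)) ≤ c + α * hlo := by
  obtain ⟨hε₀, hε₁⟩ := hε
  obtain ⟨hh₁, hh₂⟩ := hh
  have hα₀ : 0 < α := by linarith
  have hC3_pos : 0 < C3 := by
    rw [hC3]
    exact Real.sqrt_pos.mpr (by nlinarith)
  have hC2_pos : 0 < C2 := by rw [hC2]; positivity
  refine ⟨fun τ hτ => hasDerivAt_gfun hα₀ hε₀ (by linarith) hτ, ?_⟩
  generalize hx : (-1 + Real.sqrt (1 + 4 * (1 - ε) * C2)) / (2 * C2) = x at hτ2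
  obtain ⟨hx_pos, hroot⟩ := quadratic_root_spec hC2_pos (by linarith) hx.symm
  have hx_lt : x < 1 - ε := by
    have : 0 < C2 * x ^ 2 := by positivity
    linarith
  have hexp : -1 / α < 0 := div_neg_of_neg_of_pos (by norm_num) hα₀
  have hτ2_gt : 1 < τ2 := hτ2 ▸
    Real.one_lt_rpow_of_pos_of_lt_one_of_neg hx_pos (by linarith) hexp
  have hτ2_pow : τ2 ^ (-α) = x := hτ2 ▸ rpow_neg_one_div_rpow_neg hα₀.ne' hx_pos.le
  refine ⟨?_, ?_⟩
  · rw [tau0_eq_rpow_neg (by linarith), hτ2]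
    exact Real.rpow_lt_rpow_of_neg hx_pos hx_lt hexp
  generalize c + α * hlo = K at *
  have hg : gfun α ε τ2 = x * (α * C3 / (2 * ε * K)) := by
    rw [gfun, hτ2_pow, ← Real.sqrt_sq (show 0 ≤ x * (α * C3 / (2 * ε * K)) by positivity)]
    congr 1
    rw [← hroot, hC2]
    field_simp
    ring
  have hτ2_pos : 0 < τ2 := by linarith
  rw [hg, Real.rpow_sub_one hτ2_pos.ne', hτ2_pow]
  calc C3 * (α / ε * (x / τ2) / (2 * (x * (α * C3 / (2 * ε * K))))) = K / τ2 := by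
        field_simp
    _ ≤ K := div_le_self hpos.le hτ2_gt.le
end
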